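/- For each positive integer n there exists a compact set K ⊆ ℝ^{n+1} such that for every f ∈ C(K,ℝⁿ) there is a point y_f ∈ ℝⁿ with the following properties: (i) d^n_H(K) = 1 and d^n_P(K) = n+1; (ii) for a generic f ∈ C(K,ℝⁿ), dim_H f⁻¹(y) < 1 for all y ∈ ℝⁿ ∖ {y_f}; (iii) for every f ∈ C(K,ℝⁿ), dim_P f⁻¹(y) < n+1 for all y ∈ ℝⁿ ∖ {y_f}. -/

import Mathlib

open Set Metric Filter Topology TopologicalSpace
open scoped ENNReal NNReal

noncomputable section

universe u

/-- `indBelow n X` means that the small inductive (topological) dimension of `X`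
is at most `n - 1`; in particular `indBelow 0 X` means `X = ∅`. -/
def indBelow : ℕ → ∀ (X : Type u) [TopologicalSpace X], Prop
  | 0, X, _ => IsEmpty X
  | n + 1, X, inst =>
      letI := inst
      ∀ (x : X) (U : Set X), IsOpen U → x ∈ U →
        ∃ V : Set X, IsOpen V ∧ x ∈ V ∧ V ⊆ U ∧ indBelow n ↥(frontier V)

/-- The small inductive (topological) dimension, with values in `EReal`:
`-1` for the empty space and `⊤` if there is no finite bound. -/
def indDim (X : Type u) [TopologicalSpace X] : EReal :=
  sInf {d : EReal | ∃ n : ℕ, indBelow n X ∧ d = (n : EReal) - 1}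

variable {X : Type u} [MetricSpace X]

/-- Topological dimension of a subset of a metric space. -/
def tdim (A : Set X) : EReal := indDim ↥A

open Classical in
/-- Hausdorff dimension of a subset of a metric space,
with the convention `dim ∅ = -1`. -/
def hdim (A : Set X) : EReal := if A = ∅ then -1 else ((dimH A : ℝ≥0∞) : EReal)

/-- A `δ`-packing of `A`: a countable family of pairwise disjoint closed balls
with centers in `A` and radii at most `δ`. -/
def IsPacking (A : Set X) (δ : ℝ≥0) (s : Set (X × ℝ≥0)) : Prop :=
  s.Countable ∧ (∀ p ∈ s, p.1 ∈ A ∧ p.2 ≤ δ) ∧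
    s.Pairwise fun p q => Disjoint (closedBall p.1 (p.2 : ℝ)) (closedBall q.1 (q.2 : ℝ))

/-- The packing pre-measure `P^h_δ(A)`. -/
def packPre (h : ℝ≥0 → ℝ≥0) (A : Set X) (δ : ℝ≥0) : ℝ≥0∞ :=
  ⨆ (s : Set (X × ℝ≥0)) (_ : IsPacking A δ s), ∑' p : s, ((h p.1.2 : ℝ≥0) : ℝ≥0∞)

/-- The packing pre-measure (packing number) `P^h₀(A) = lim_{δ → 0+} P^h_δ(A)`. -/
def packPre0 (h : ℝ≥0 → ℝ≥0) (A : Set X) : ℝ≥0∞ :=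
  ⨅ (δ : ℝ≥0) (_ : 0 < δ), packPre h A δ

/-- The `h`-packing measure `𝒫^h(A)`. -/
def packMeasure (h : ℝ≥0 → ℝ≥0) (A : Set X) : ℝ≥0∞ :=
  ⨅ (c : ℕ → Set X) (_ : A = ⋃ i, c i), ∑' i, packPre0 h (c i)

open Classical in
/-- The packing dimension, with the convention `dim ∅ = -1`. -/
def pdim (A : Set X) : EReal :=
  if A = ∅ then -1
  else max 0 (⨆ (s : ℝ≥0) (_ : packMeasure (fun r => r ^ (s : ℝ)) A = ∞), ((s : ℝ) : EReal))

/-- The restriction of the packing measure `𝒫^h` to `A` is σ-finite. -/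
def PackSigmaFiniteOn (h : ℝ≥0 → ℝ≥0) (A : Set X) : Prop :=
  ∃ c : ℕ → Set X, A ⊆ ⋃ i, c i ∧ ∀ i, packMeasure h (A ∩ c i) < ∞

/-- The generalized Hausdorff measure `ℋ^h(A)` associated to a gauge function `h`. -/
def hMeasure (h : ℝ≥0 → ℝ≥0) (A : Set X) : ℝ≥0∞ :=
  ⨆ (δ : ℝ≥0) (_ : 0 < δ),
    ⨅ (c : ℕ → Set X) (_ : A ⊆ ⋃ i, c i) (_ : ∀ i, EMetric.diam (c i) ≤ (δ : ℝ≥0∞)),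
      ∑' i, ((h (EMetric.diam (c i)).toNNReal : ℝ≥0) : ℝ≥0∞)

/-- `F` is an `F_σ` subset of the subspace `A`. -/
def IsFSigmaIn (F A : Set X) : Prop :=
  ∃ C : ℕ → Set X, (∀ i, IsClosed (C i)) ∧ F = ⋃ i, C i ∩ A

/-- `d^n_*(A) = inf {dim_*(A ∖ F) : F ⊆ A is F_σ in A and dim_T F ≤ n - 1}`. -/
def dStar (dim : Set X → EReal) (n : ℕ) (A : Set X) : EReal :=
  sInf {d : EReal |
    ∃ F : Set X, IsFSigmaIn F A ∧ tdim F ≤ (n : EReal) - 1 ∧ d = dim (A \ F)}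

end

section InductiveDimension

universe u

theorem exists_polynomial_det_one_add_smul {E : Type*} [NormedAddCommGroup E]
    [InnerProductSpace ℝ E]
    [FiniteDimensional ℝ E] (A : E →L[ℝ] E) :
    ∃ P : Polynomial ℝ, P.natDegree ≤ Module.finrank ℝ E ∧
      ∀ t : ℝ, P.eval t = (ContinuousLinearMap.id ℝ _ + t • A).det := by
  classical
  let b := Module.finBasis ℝ E
  let M := LinearMap.toMatrix b b (A : E →ₗ[ℝ] E)
  refine ⟨Matrix.det ((Polynomial.X : Polynomial ℝ) • M.map Polynomial.C +
    (1 : Matrix _ _ ℝ).map Polynomial.C), ?_, fun t => ?_⟩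
  · simpa using Polynomial.natDegree_det_X_add_C_le M 1
  · rw [← Polynomial.coe_evalRingHom, RingHom.map_det, ContinuousLinearMap.det,
      ← LinearMap.det_toMatrix b]
    congr 1
    ext i j
    have h1 : LinearMap.toMatrix b b
        ((ContinuousLinearMap.id ℝ E + t • A : E →L[ℝ] E) : E →ₗ[ℝ] E) = 1 + t • M := by
      rw [← LinearMap.toMatrix_id b, ← map_smul, ← map_add]
      rfl
    rw [h1]
    by_cases hij : i = j <;> simp [hij] <;> ring

theorem det_fderiv_eq_zero_of_norm_eq_one {E : Type*} [NormedAddCommGroup E]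
    [InnerProductSpace ℝ E] [FiniteDimensional ℝ E] {R : E → E} {U : Set E} (hU : IsOpen U)
    (hR : DifferentiableOn ℝ R U) (h1 : ∀ x ∈ U, ‖R x‖ = 1) {x : E} (hx : x ∈ U) :
    (fderiv ℝ R x).det = 0 := by
  by_contra hdet
  have hd : HasFDerivAt R (fderiv ℝ R x) x :=
    ((hR x hx).differentiableAt (hU.mem_nhds hx)).hasFDerivAt
  have h2 := hd.inner ℝ hd
  have h3 : HasFDerivAt (fun t => inner ℝ (R t) (R t)) (0 : E →L[ℝ] ℝ) x := by
    refine (hasFDerivAt_const (1 : ℝ) x).congr_of_eventuallyEq ?_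
    filter_upwards [hU.mem_nhds hx] with y hy
    rw [real_inner_self_eq_norm_sq, h1 y hy, one_pow]
  have h4 := h2.unique h3
  let e := (fderiv ℝ R x).toContinuousLinearEquivOfDetNeZero hdet
  obtain ⟨v, hv⟩ := e.surjective (R x)
  have hv' : fderiv ℝ R x v = R x := hv
  have h5 := congrArg (fun L : E →L[ℝ] ℝ => L v) h4
  simp [hv', h1 x hx] at h5

/-- For small `t`, the map `x ↦ x + t • (R x - x)` is a diffeomorphism of the open unit ball
as soon as `R` is a `C¹` self-map of the closed ball fixing the sphere. -/
theorem eventually_integral_det_eq_volume {E : Type*} [NormedAddCommGroup E] [InnerProductSpace ℝ E]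
    [FiniteDimensional ℝ E]
    [MeasurableSpace E] [BorelSpace E]
    {R : E → E} (hR : ContDiff ℝ 1 R)
    (h1 : ∀ x, ‖x‖ ≤ 1 → ‖R x‖ ≤ 1) (hid : ∀ x, ‖x‖ = 1 → R x = x) :
    ∀ᶠ t : ℝ in 𝓝[>] 0,
      ∫ x in ball (0 : E) 1,
        (ContinuousLinearMap.id ℝ _ + t • fderiv ℝ (fun x => R x - x) x).det =
      MeasureTheory.volume.real (ball (0 : E) 1) := by
  set h : E → E := fun x => R x - x with hh
  have hC : ContDiff ℝ 1 h := hR.sub contDiff_fun_id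
  have hdc : Continuous (fderiv ℝ h) := hC.continuous_fderiv one_ne_zero
  have hcomp : IsCompact (closedBall (0 : E) 1) := isCompact_closedBall 0 1
  obtain ⟨C, hCb⟩ := (hcomp.image (hdc.nnnorm)).bddAbove
  have hlip : LipschitzOnWith C h (closedBall (0 : E) 1) :=
    Convex.lipschitzOnWith_of_nnnorm_fderiv_le
      (fun x _ => (hC.differentiable one_ne_zero).differentiableAt)
      (fun x hx => hCb ⟨x, hx, rfl⟩) (convex_closedBall 0 1)
  have hdetc : Continuous fun p : ℝ × E =>
      (ContinuousLinearMap.id ℝ E + p.1 • fderiv ℝ h p.2).det :=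
    ContinuousLinearMap.continuous_det.comp (by fun_prop)
  have hpos : ∀ᶠ t : ℝ in 𝓝 0, ∀ x ∈ closedBall (0 : E) 1,
      0 < (ContinuousLinearMap.id ℝ E + t • fderiv ℝ h x).det := by
    refine hcomp.eventually_forall_of_forall_eventually fun x _ => ?_
    refine (hdetc.tendsto (0, x)).eventually_const_lt ?_
    simp [ContinuousLinearMap.det]
  have hsmall : ∀ᶠ t : ℝ in 𝓝 0, t * C < 1 := by
    refine ((continuous_id.mul continuous_const).tendsto (0 : ℝ)).eventually_lt_const ?_
    simp
  have hle : ∀ᶠ t : ℝ in 𝓝 0, t < 1 := eventually_lt_nhds one_pos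
  filter_upwards [nhdsWithin_le_nhds hpos, nhdsWithin_le_nhds hsmall, nhdsWithin_le_nhds hle,
    self_mem_nhdsWithin] with t htpos htC ht1 ht0
  have ht0 : 0 < t := ht0
  set φ : E → E := fun x => x + t • h x with hφ
  have hφd : ∀ x, HasStrictFDerivAt φ (ContinuousLinearMap.id ℝ E + t • fderiv ℝ h x) x :=
    fun x => (hasStrictFDerivAt_id x).add
      ((hC.contDiffAt.hasStrictFDerivAt one_ne_zero).const_smul t)
  have hinj : InjOn φ (closedBall (0 : E) 1) := by
    intro x hx y hy hxy
    by_contra hne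
    have h2 : ‖h x - h y‖ ≤ C * ‖x - y‖ := hlip.norm_sub_le hx hy
    have h3 : x - y = -(t • (h x - h y)) := by
      have : x + t • h x = y + t • h y := hxy
      rw [smul_sub]
      rw [eq_comm, ← sub_eq_zero] at this
      rw [← sub_eq_zero, ← neg_eq_zero, ← this]
      abel
    have h4 : ‖x - y‖ ≤ t * (C * ‖x - y‖) := by
      conv_lhs => rw [h3, norm_neg, norm_smul, Real.norm_of_nonneg ht0.le]
      gcongr
    have h5 : 0 < ‖x - y‖ := norm_pos_iff.2 (sub_ne_zero.2 hne)
    nlinarith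
  have hsph : ∀ x, ‖x‖ = 1 → φ x = x := fun x hx => by simp [hφ, hh, hid x hx]
  have hball : ∀ x, ‖x‖ < 1 → ‖φ x‖ < 1 := fun x hx => by
    have : φ x = (1 - t) • x + t • R x := by simp only [hφ, hh, smul_sub, sub_smul, one_smul]; abel
    rw [this]
    calc ‖(1 - t) • x + t • R x‖ ≤ ‖(1 - t) • x‖ + ‖t • R x‖ := norm_add_le _ _
      _ = (1 - t) * ‖x‖ + t * ‖R x‖ := by
        rw [norm_smul, norm_smul, Real.norm_of_nonneg ht0.le, Real.norm_of_nonneg (by linarith)]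
      _ < 1 := by nlinarith [h1 x hx.le]
  have hφc : Continuous φ := by
    have := hC.continuous
    fun_prop
  have hopen : IsOpen (φ '' ball (0 : E) 1) := by
    rw [isOpen_iff_mem_nhds]
    rintro _ ⟨x, hx, rfl⟩
    have hd := (htpos x (ball_subset_closedBall hx)).ne'
    let e := (ContinuousLinearMap.id ℝ E + t • fderiv ℝ h x).toContinuousLinearEquivOfDetNeZero hd
    have hm : map φ (𝓝 x) = 𝓝 (φ x) :=
      HasStrictFDerivAt.map_nhds_eq_of_equiv (f' := e) (hφd x)
    rw [← hm]
    exact image_mem_map (isOpen_ball.mem_nhds hx)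
  have himage : φ '' ball (0 : E) 1 = ball 0 1 := by
    have hsub : φ '' ball (0 : E) 1 ⊆ ball 0 1 := by
      rintro _ ⟨x, hx, rfl⟩
      simpa using hball x (by simpa using hx)
    have hcl : φ '' ball (0 : E) 1 = φ '' closedBall 0 1 ∩ ball 0 1 := by
      refine Subset.antisymm (fun y hy => ⟨image_mono ball_subset_closedBall hy, hsub hy⟩) ?_
      rintro _ ⟨⟨x, hx, rfl⟩, hy⟩
      rcases (mem_closedBall_zero_iff.1 hx).lt_or_eq with h2 | h2
      · exact ⟨x, by simpa using h2, rfl⟩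
      · rw [hsph x h2] at hy
        simp [h2] at hy
    refine Subset.antisymm hsub ?_
    have hpre : IsPreconnected (ball (0 : E) 1) := (convex_ball 0 1).isPreconnected
    have h0 : (0 : E) ∈ ball (0 : E) 1 := mem_ball_self one_pos
    refine hpre.subset_left_of_subset_union hopen
      (v := (φ '' closedBall (0 : E) 1)ᶜ) (hcomp.image hφc).isClosed.isOpen_compl ?_ ?_ ?_
    · exact disjoint_compl_right_iff_subset.2 (image_mono ball_subset_closedBall)
    · intro y hy
      by_cases h2 : y ∈ φ '' closedBall (0 : E) 1
      · left; rw [hcl]; exact ⟨h2, hy⟩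
      · exact Or.inr h2
    · exact ⟨φ 0, hsub ⟨0, h0, rfl⟩, ⟨0, h0, rfl⟩⟩
  have hcv := MeasureTheory.integral_image_eq_integral_abs_det_fderiv_smul
    (MeasureTheory.volume : MeasureTheory.Measure E) measurableSet_ball
    (fun x _ => (hφd x).hasFDerivAt.hasFDerivWithinAt) (hinj.mono ball_subset_closedBall)
    (fun _ => (1 : ℝ))
  rw [himage] at hcv
  simp only [MeasureTheory.integral_const, smul_eq_mul, mul_one,
    MeasureTheory.measureReal_restrict_apply_univ] at hcv
  rw [hcv]
  refine MeasureTheory.setIntegral_congr_fun measurableSet_ball fun x hx => ?_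
  exact (abs_of_pos (htpos x (ball_subset_closedBall hx))).symm

theorem not_exists_contDiff_retraction {E : Type*} [NormedAddCommGroup E] [InnerProductSpace ℝ E]
    [FiniteDimensional ℝ E]
    [MeasurableSpace E] [BorelSpace E]
    {R : E → E} (hR : ContDiff ℝ 1 R)
    (h1 : ∀ x, ‖x‖ ≤ 1 → ‖R x‖ = 1) (hid : ∀ x, ‖x‖ = 1 → R x = x) : False := by
  have hev := eventually_integral_det_eq_volume hR (fun x hx => (h1 x hx).le) hid
  obtain ⟨ε, hε, hsub⟩ := mem_nhdsGT_iff_exists_Ioo_subset.1 hev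
  have hε : 0 < ε := hε
  obtain ⟨v, hv⟩ := (Ioo_infinite hε).exists_subset_card_eq (Module.finrank ℝ E + 1)
  obtain ⟨hv, hcard⟩ := hv
  set D : E → E →L[ℝ] E := fun x => fderiv ℝ (fun x => R x - x) x
  have hDc : Continuous D := (hR.sub contDiff_fun_id).continuous_fderiv one_ne_zero
  set d : ℝ → E → ℝ := fun t x => (ContinuousLinearMap.id ℝ E + t • D x).det with hd
  have hint : ∀ t, MeasureTheory.IntegrableOn (d t) (ball (0 : E) 1) := fun t => by
    have hc : Continuous (d t) := ContinuousLinearMap.continuous_det.comp (by fun_prop)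
    exact (hc.continuousOn.integrableOn_compact (isCompact_closedBall (0 : E) 1)).mono_set
      ball_subset_closedBall
  have hlag : ∀ x, d 1 x = ∑ i ∈ v, (Lagrange.basis v id i).eval 1 * d i x := fun x => by
    obtain ⟨P, hP, hPe⟩ := exists_polynomial_det_one_add_smul (D x)
    have h2 : P = Lagrange.interpolate v id fun i => P.eval (id i) := by
      refine Lagrange.eq_interpolate (injOn_id _) ?_
      rw [hcard]
      exact lt_of_le_of_lt Polynomial.degree_le_natDegree (by exact_mod_cast Nat.lt_succ_of_le hP)
    have h3 := congrArg (Polynomial.eval 1) h2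
    rw [Lagrange.interpolate_apply, Polynomial.eval_finsetSum, hPe] at h3
    simp only [hd]
    rw [h3]
    exact Finset.sum_congr rfl fun i _ => by simp [hPe, mul_comm]
  have hone : ∑ i ∈ v, (Lagrange.basis v id i).eval (1 : ℝ) = 1 := by
    rw [← Polynomial.eval_finsetSum, Lagrange.sum_basis (injOn_id _)]
    · simp
    · exact Finset.card_pos.1 (by omega)
  have hI : ∫ x in ball (0 : E) 1, d 1 x = MeasureTheory.volume.real (ball (0 : E) 1) := by
    simp_rw [hlag]
    rw [MeasureTheory.integral_finsetSum _ fun i _ => (hint i).const_mul _]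
    simp_rw [MeasureTheory.integral_const_mul]
    have hmul : MeasureTheory.volume.real (ball (0 : E) 1) = (∑ i ∈ v,
        (Lagrange.basis v id i).eval (1 : ℝ)) * MeasureTheory.volume.real (ball (0 : E) 1) := by
      rw [hone, one_mul]
    rw [hmul, Finset.sum_mul]
    refine Finset.sum_congr rfl fun i hi => ?_
    congr 1
    exact hsub (hv hi)
  have hzero : ∫ x in ball (0 : E) 1, d 1 x = 0 := by
    rw [← MeasureTheory.integral_zero (α := E) (G := ℝ)]
    refine MeasureTheory.setIntegral_congr_fun measurableSet_ball fun x hx => ?_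
    have hRd := hR.differentiable one_ne_zero
    have : ContinuousLinearMap.id ℝ E + (1 : ℝ) • D x = fderiv ℝ R x := by
      simp only [D]
      rw [fderiv_fun_sub hRd.differentiableAt differentiableAt_fun_id]
      simp
    simp only [hd, this]
    exact det_fderiv_eq_zero_of_norm_eq_one isOpen_ball hRd.differentiableOn
      (fun y hy => h1 y (by simpa using (mem_ball_zero_iff.1 hy).le)) hx
  have hvol : 0 < MeasureTheory.volume.real (ball (0 : E) 1) :=
    ENNReal.toReal_pos (measure_ball_pos _ _ one_pos).ne' MeasureTheory.measure_ball_lt_top.ne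
  linarith

theorem exists_zero_of_eq_id_off_ball {E : Type*} [NormedAddCommGroup E] [InnerProductSpace ℝ E]
    [FiniteDimensional ℝ E] {G : E → E} (hG : Continuous G)
    (hid : ∀ x, 1 / 2 ≤ ‖x‖ → G x = x) : ∃ x, G x = 0 := by
  by_contra! hne
  let _ : MeasurableSpace E := borel E
  have : BorelSpace E := ⟨rfl⟩
  obtain ⟨g, hg⟩ := exists_contMDiffMap_forall_mem_convex_of_local (M := E) (F := E)
    (modelWithCornersSelf ℝ E) (n := (1 : ℕ∞))
    (t := fun x => {v | v ∈ ball (G x) ‖G x‖ ∧ (1 ≤ ‖x‖ → v = x)}) (fun x => by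
      refine (convex_ball _ _).inter ?_
      intro v hv w hw a b _ _ hab h1
      rw [hv h1, hw h1, ← add_smul, hab, one_smul]) (fun x => by
      rcases lt_or_ge ‖x‖ 1 with hx | hx
      · refine ⟨{y | ‖y‖ < 1 ∧ G x ∈ ball (G y) ‖G y‖}, ?_, fun _ => G x, contMDiffOn_const, ?_⟩
        · refine IsOpen.mem_nhds ?_ ⟨hx, by simpa using hne x⟩
          simp only [mem_ball]
          exact (isOpen_lt continuous_norm continuous_const).inter
            (isOpen_lt (continuous_const.dist hG) hG.norm)
        · rintro y ⟨hy, hy'⟩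
          exact ⟨hy', fun h => absurd hy h.not_gt⟩
      · refine ⟨{y | 1 / 2 < ‖y‖}, ?_, id, contMDiffOn_id, ?_⟩
        · exact (isOpen_lt continuous_const continuous_norm).mem_nhds
            (by simp only [mem_ofPred_eq]; linarith)
        · intro y hy
          refine ⟨?_, fun _ => rfl⟩
          have h1 := hne y
          rw [hid y hy.le] at h1 ⊢
          simpa using h1)
  have hgne : ∀ x, g x ≠ 0 := fun x h0 => by
    have := (hg x).1
    rw [h0] at this
    simp at this
  have hgd : ContDiff ℝ 1 g := g.contMDiff.contDiff
  refine not_exists_contDiff_retraction (R := fun x => ‖g x‖⁻¹ • g x) ?_ ?_ ?_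
  · exact ((hgd.norm ℝ hgne).inv fun x => norm_ne_zero_iff.2 (hgne x)).smul hgd
  · intro x _
    simp [norm_smul, hgne x]
  · intro x hx
    have := (hg x).2 hx.ge
    simp [this, hx]

/-- Every map from a subset `A` of a closed set `S` into the punctured space `ℝ^k ∖ {0}` that
extends continuously to the whole space also extends over `S` without zeros. -/
def ExtendsOn {X : Type*} [TopologicalSpace X] (k : ℕ) (S : Set X) : Prop :=
  ∀ (A : Set X) (g : C(X, Fin k → ℝ)), IsClosed A → (∀ x ∈ A ∩ S, g x ≠ 0) →
    ∃ g' : C(X, Fin k → ℝ), (∀ x ∈ S, g' x ≠ 0) ∧ ∀ x ∈ A, g' x = g x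

theorem exists_continuousMap_eq_on {X : Type*} [TopologicalSpace X] [NormalSpace X] {k : ℕ}
    {A S : Set X} (hA : IsClosed A) (hS : IsClosed S) (u : C(X, Fin k → ℝ))
    (v : C(S, Fin k → ℝ)) (h : ∀ x (hx : x ∈ S), x ∈ A → v ⟨x, hx⟩ = u x) :
    ∃ w : C(X, Fin k → ℝ), (∀ x ∈ A, w x = u x) ∧ ∀ x (hx : x ∈ S), w x = v ⟨x, hx⟩ := by
  classical
  obtain ⟨v', hv'⟩ := v.exists_restrict_eq hS
  have hv'' : ∀ x (hx : x ∈ S), v' x = v ⟨x, hx⟩ := fun x hx => by rw [← hv']; rfl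
  let f : X → Fin k → ℝ := fun x => if x ∈ A then u x else v' x
  have hfA : ∀ x ∈ A, f x = u x := fun x hx => if_pos hx
  have hfS : ∀ x (hx : x ∈ S), f x = v ⟨x, hx⟩ := fun x hx => by
    by_cases hxA : x ∈ A
    · rw [hfA x hxA, h x hx hxA]
    · simp only [f, if_neg hxA, hv'' x hx]
  have hf : ContinuousOn f (A ∪ S) :=
    ContinuousOn.union_of_isClosed (u.continuous.continuousOn.congr hfA)
      (v'.continuous.continuousOn.congr fun x hx => by rw [hfS x hx, hv'' x hx]) hA hS
  obtain ⟨w, hw⟩ := ContinuousMap.exists_restrict_eq (hA.union hS)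
    (⟨(A ∪ S).domRestrict f, hf.domRestrict⟩ : C(↥(A ∪ S), Fin k → ℝ))
  have hw' : ∀ x ∈ A ∪ S, w x = f x := fun x hx => DFunLike.congr_fun hw ⟨x, hx⟩
  exact ⟨w, fun x hx => by rw [hw' x (Or.inl hx), hfA x hx],
    fun x hx => by rw [hw' x (Or.inr hx), hfS x hx]⟩

theorem ExtendsOn.of_subtype {X : Type*} [TopologicalSpace X] [NormalSpace X] {k : ℕ} {S : Set X}
    (hS : IsClosed S) (h : ExtendsOn k (univ : Set ↥S)) : ExtendsOn k S := by
  intro A g hA hg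
  obtain ⟨g', h1, h2⟩ := h (Subtype.val ⁻¹' A) (g.comp ⟨Subtype.val, continuous_subtype_val⟩)
    (hA.preimage continuous_subtype_val) fun x hx => hg x ⟨hx.1, x.2⟩
  obtain ⟨w, hw, hw'⟩ := exists_continuousMap_eq_on hA hS g g' fun x hx hxA => h2 ⟨x, hx⟩ hxA
  exact ⟨w, fun x hx => by rw [hw' x hx]; exact h1 _ trivial, hw⟩

theorem ExtendsOn.mono {X : Type*} [TopologicalSpace X] [NormalSpace X] {k : ℕ} {S T : Set X}
    (hT : IsClosed T) (hTS : T ⊆ S) (h : ExtendsOn k S) : ExtendsOn k T := by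
  intro A g hA hg
  obtain ⟨g', h1, h2⟩ := h (A ∩ T) g (hA.inter hT) fun x hx => hg x hx.1
  obtain ⟨w, hw, hw'⟩ := exists_continuousMap_eq_on hA hT g
    (g'.comp ⟨Subtype.val, continuous_subtype_val⟩) fun x hx hxA => h2 x ⟨hxA, hx⟩
  exact ⟨w, fun x hx => by rw [hw' x hx]; exact h1 _ (hTS hx), hw⟩

theorem ExtendsOn.union {X : Type*} [TopologicalSpace X] {k : ℕ} {S T : Set X}
    (hS : IsClosed S) (h : ExtendsOn k S) (h' : ExtendsOn k T) : ExtendsOn k (S ∪ T) := by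
  intro A g hA hg
  obtain ⟨g₁, h1, h2⟩ := h A g hA fun x hx => hg x ⟨hx.1, Or.inl hx.2⟩
  obtain ⟨g₂, h3, h4⟩ := h' (A ∪ S) g₁ (hA.union hS) (by
    rintro x ⟨hx | hx, hxT⟩
    · rw [h2 x hx]; exact hg x ⟨hx, Or.inr hxT⟩
    · exact h1 x hx)
  refine ⟨g₂, ?_, fun x hx => by rw [h4 x (Or.inl hx), h2 x hx]⟩
  rintro x (hx | hx)
  · rw [h4 x (Or.inr hx)]; exact h1 x hx
  · exact h3 x hx

theorem ExtendsOn.biUnion {X ι : Type*} [TopologicalSpace X] {k : ℕ} (t : Finset ι)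
    {S : ι → Set X} (hS : ∀ i ∈ t, IsClosed (S i)) (h : ∀ i ∈ t, ExtendsOn k (S i)) :
    ExtendsOn k (⋃ i ∈ t, S i) := by
  classical
  induction t using Finset.induction_on with
  | empty => exact fun A g _ _ => ⟨g, by simp, fun _ _ => rfl⟩
  | insert i t hi ih =>
    rw [Finset.set_biUnion_insert]
    exact (h i (by simp)).union (hS i (by simp))
      (ih (fun j hj => hS j (by simp [hj])) fun j hj => h j (by simp [hj]))

theorem exists_continuousMap_eq_zero_iff {X : Type*} [MetricSpace X] (S : Set X) :
    ∃ u : C(X, ℝ), (∀ x, 0 ≤ u x) ∧ ∀ x, u x = 0 ↔ x ∈ closure S := by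
  rcases S.eq_empty_or_nonempty with rfl | hS
  · exact ⟨⟨fun _ => 1, continuous_const⟩, fun _ => zero_le_one, fun x => by simp⟩
  · exact ⟨⟨fun x => infDist x S, continuous_infDist_pt S⟩, fun x => infDist_nonneg,
      fun x => (mem_closure_iff_infDist_zero hS).symm⟩

/-- A compact metric space of inductive dimension at most `k - 1` has the extension property
for maps into the punctured `k`-dimensional space. -/
theorem extendsOn_univ_of_indBelow : ∀ (k : ℕ) (X : Type u) [MetricSpace X] [CompactSpace X],
    indBelow k X → ExtendsOn k (univ : Set X) := by
  intro k
  induction k with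
  | zero =>
    intro X _ _ h A g _ _
    have : IsEmpty X := h
    exact ⟨g, fun x => isEmptyElim x, fun x => isEmptyElim x⟩
  | succ k ih =>
    intro X _ _ h A g hA hg
    obtain ⟨ε, hε, hεA⟩ : ∃ ε > 0, ∀ x ∈ A, ε ≤ ‖g x‖ := by
      obtain ⟨ε, hε, h'⟩ := hA.isCompact.exists_forall_le' (f := fun x => ‖g x‖) (a := 0)
        g.continuous.norm.continuousOn fun x hx => norm_pos_iff.2 (hg x ⟨hx, trivial⟩)
      exact ⟨ε, hε, h'⟩
    have hg0 : Continuous fun x => g x 0 := (continuous_apply 0).comp g.continuous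
    set P : Set X := {x | ε ≤ g x 0} with hP
    have hPc : IsCompact P := (isClosed_le continuous_const hg0).isCompact
    choose! V hVo hxV hVU hVf using fun x (hx : 0 < g x 0) =>
      h x {y | 0 < g y 0} (isOpen_lt continuous_const hg0) hx
    have hpos : ∀ x ∈ P, 0 < g x 0 := fun x hx => hε.trans_le hx
    obtain ⟨t, htP, hPt⟩ := hPc.elim_nhds_subcover V
      fun x hx => (hVo x (hpos x hx)).mem_nhds (hxV x (hpos x hx))
    set W : Set X := ⋃ x ∈ t, V x with hW
    have hWo : IsOpen W := isOpen_biUnion fun x hx => hVo x (hpos x (htP x hx))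
    have hWcl : closure W ⊆ {y | 0 ≤ g y 0} := by
      refine closure_minimal ?_ (isClosed_le continuous_const hg0)
      refine iUnion₂_subset fun x hx y hy => ?_
      have : 0 < g y 0 := hVU x (hpos x (htP x hx)) hy
      exact this.le
    have hfr : frontier W ⊆ ⋃ x ∈ t, frontier (V x) := by
      intro y hy
      rw [hWo.frontier_eq, hW, Finset.closure_biUnion] at hy
      obtain ⟨hy1, hy2⟩ := hy
      simp only [mem_iUnion, not_exists] at hy1 hy2 ⊢
      obtain ⟨x, hx, hxy⟩ := hy1
      refine ⟨x, hx, ?_⟩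
      rw [(hVo x (hpos x (htP x hx))).frontier_eq]
      exact ⟨hxy, hy2 x hx⟩
    have hext : ExtendsOn k (frontier W) := by
      refine ExtendsOn.mono isClosed_frontier hfr (ExtendsOn.biUnion t
        (fun _ _ => isClosed_frontier) fun x hx => ?_)
      have : CompactSpace ↥(frontier (V x)) :=
        isCompact_iff_compactSpace.1 isClosed_frontier.isCompact
      exact ExtendsOn.of_subtype isClosed_frontier
        (ih ↥(frontier (V x)) (hVf x (hpos x (htP x hx))))
    have hnorm : ∀ x, |g x 0| < ε → (∀ i : Fin k, g x i.succ = 0) → ‖g x‖ < ε := by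
      intro x h0 h1
      refine (pi_norm_lt_iff hε).2 fun i => ?_
      refine Fin.cases h0 (fun i => ?_) i
      rw [h1 i, norm_zero]
      exact hε
    let gt : C(X, Fin k → ℝ) := ⟨fun x i => g x i.succ,
      continuous_pi fun i => (continuous_apply i.succ).comp g.continuous⟩
    have hgt : ∀ x ∈ A ∩ frontier W, gt x ≠ 0 := by
      rintro x ⟨hxA, hxW⟩ h0
      refine (hεA x hxA).not_gt (hnorm x (abs_lt.2 ⟨?_, ?_⟩) fun i => congrFun h0 i)
      · have : 0 ≤ g x 0 := hWcl hxW.1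
        linarith
      · by_contra! hx
        rw [hWo.frontier_eq] at hxW
        exact hxW.2 (hPt hx)
    obtain ⟨ĝ, hĝ, hĝA⟩ := hext A gt hA hgt
    obtain ⟨u, hu0, hu⟩ := exists_continuousMap_eq_zero_iff Wᶜ
    obtain ⟨v, hv0, hv⟩ := exists_continuousMap_eq_zero_iff W
    rw [hWo.isClosed_compl.closure_eq] at hu
    set φ : X → ℝ := fun x => u x - v x with hφ
    have hφc : Continuous φ := u.continuous.sub v.continuous
    have hφpos : ∀ x ∈ W, 0 < φ x := fun x hx => by
      have h1 : v x = 0 := (hv x).2 (subset_closure hx)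
      have h2 : u x ≠ 0 := fun h => (hu x).1 h hx
      simpa [hφ, h1] using lt_of_le_of_ne (hu0 x) h2.symm
    have hφneg : ∀ x, x ∉ closure W → φ x < 0 := fun x hx => by
      have h1 : u x = 0 := (hu x).2 fun h => hx (subset_closure h)
      have h2 : v x ≠ 0 := fun h => hx ((hv x).1 h)
      simpa [hφ, h1] using lt_of_le_of_ne (hv0 x) h2.symm
    have hφ0 : ∀ x, φ x = 0 → x ∈ frontier W := fun x hx => by
      rw [hWo.frontier_eq]
      exact ⟨by_contra fun h => (hφneg x h).ne hx, fun h => (hφpos x h).ne' hx⟩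
    set Z : Set X := {x | ĝ x = 0 ∧ g x 0 * φ x ≤ 0}
    have hZ : IsClosed Z := (isClosed_eq ĝ.continuous continuous_const).inter
      (isClosed_le (hg0.mul hφc) continuous_const)
    have hAZ : Disjoint A Z := by
      refine disjoint_left.2 fun x hxA hxZ => ?_
      have h1 : ε ≤ |g x 0| := by
        by_contra! hlt
        refine (hεA x hxA).not_gt (hnorm x hlt fun i => ?_)
        have := hĝA x hxA
        rw [hxZ.1] at this
        exact (congrFun this i).symm
      have h2 := hxZ.2
      rcases le_abs.1 h1 with h3 | h3
      · have := hφpos x (hPt h3)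
        nlinarith
      · have := hφneg x fun h => by
          have : 0 ≤ g x 0 := hWcl h
          linarith
        nlinarith
    obtain ⟨τ, hτA, hτZ, hτ⟩ := exists_continuous_zero_one_of_isClosed hA hZ hAZ
    refine ⟨⟨fun x => Fin.cons ((1 - τ x) * g x 0 + τ x * φ x) (ĝ x), ?_⟩, ?_, ?_⟩
    · refine continuous_pi fun i => Fin.cases ?_ (fun i => ?_) i
      · simp only [Fin.cons_zero]
        fun_prop
      · simp only [Fin.cons_succ]
        fun_prop
    · intro x _ h0
      have h1 : (1 - τ x) * g x 0 + τ x * φ x = 0 := congrFun h0 0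
      have h2 : ĝ x = 0 := funext fun i => congrFun h0 i.succ
      have h3 : φ x ≠ 0 := fun h => hĝ x (hφ0 x h) h2
      by_cases hx : x ∈ Z
      · have := hτZ hx
        simp only [Pi.one_apply] at this
        rw [this] at h1
        exact h3 (by linarith)
      · have h4 : 0 < g x 0 * φ x := by
          by_contra! h5
          exact hx ⟨h2, h5⟩
        have h5 := hτ x
        rcases pos_and_pos_or_neg_and_neg_of_mul_pos h4 with ⟨h6, h7⟩ | ⟨h6, h7⟩
        · rcases h5.1.eq_or_lt with h8 | h8
          · rw [← h8] at h1
            linarith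
          · nlinarith [mul_pos h8 h7, mul_nonneg (sub_nonneg.2 h5.2) h6.le]
        · rcases h5.1.eq_or_lt with h8 | h8
          · rw [← h8] at h1
            linarith
          · nlinarith [mul_neg_of_pos_of_neg h8 h7,
              mul_nonneg (sub_nonneg.2 h5.2) (neg_nonneg.2 h6.le)]
    · intro x hx
      have h1 := hτA hx
      simp only [Pi.zero_apply] at h1
      funext i
      refine Fin.cases ?_ (fun i => ?_) i
      · simp [h1]
      · simp [hĝA x hx, gt]

theorem not_indBelow_closedBall (n : ℕ) :
    ¬ indBelow n ↥(closedBall (0 : EuclideanSpace ℝ (Fin n)) 1) := by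
  intro h
  have : CompactSpace ↥(closedBall (0 : EuclideanSpace ℝ (Fin n)) 1) :=
    isCompact_iff_compactSpace.1 (isCompact_closedBall _ _)
  obtain ⟨g, hg, hgA⟩ := extendsOn_univ_of_indBelow n _ h {x | 1 / 2 ≤ ‖x.1‖}
    ⟨fun x => WithLp.ofLp x.1, by fun_prop⟩
    (isClosed_le continuous_const (by fun_prop)) (by
      rintro x ⟨hx, -⟩ h0
      have : x.1 = 0 := (WithLp.ofLp_eq_zero 2).1 h0
      rw [mem_ofPred_eq, this, norm_zero] at hx
      norm_num at hx)
  let c : EuclideanSpace ℝ (Fin n) → EuclideanSpace ℝ (Fin n) := fun x => (max 1 ‖x‖)⁻¹ • x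
  have hm : ∀ x : EuclideanSpace ℝ (Fin n), 0 < max 1 ‖x‖ := fun x => by positivity
  have hc : Continuous c :=
    ((continuous_const.max continuous_norm).inv₀ fun x => (hm x).ne').smul continuous_id
  have hcn : ∀ x, ‖c x‖ = (max 1 ‖x‖)⁻¹ * ‖x‖ := fun x => by
    rw [norm_smul, norm_inv, Real.norm_of_nonneg (hm x).le]
  have hc1 : ∀ x, c x ∈ closedBall (0 : EuclideanSpace ℝ (Fin n)) 1 := fun x => by
    rw [mem_closedBall_zero_iff, hcn, inv_mul_le_iff₀ (hm x), mul_one]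
    exact le_max_right _ _
  have hc2 : ∀ x, ‖x‖ ≤ 1 → c x = x := fun x hx => by simp [c, hx]
  have hc3 : ∀ x, 1 ≤ ‖x‖ → ‖c x‖ = 1 := fun x hx => by
    rw [hcn, max_eq_right hx, inv_mul_cancel₀ (by linarith)]
  have hgc : ∀ x, 1 / 2 ≤ ‖c x‖ → WithLp.toLp 2 (g ⟨c x, hc1 x⟩) = c x := fun x hx => by
    rw [hgA ⟨c x, hc1 x⟩ hx]
    rfl
  have hc4 : ∀ x, 1 / 2 ≤ ‖x‖ → 1 / 2 ≤ ‖c x‖ := fun x hx => by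
    rcases le_total ‖x‖ 1 with h1 | h1
    · rwa [hc2 x h1]
    · rw [hc3 x h1]; norm_num
  obtain ⟨x, hx⟩ := exists_zero_of_eq_id_off_ball
    (G := fun x => WithLp.toLp 2 (g ⟨c x, hc1 x⟩) + (x - c x)) (by fun_prop)
    (fun x hx => by rw [hgc x (hc4 x hx)]; abel)
  rcases le_total ‖x‖ 1 with h1 | h1
  · have h2 : x - c x = 0 := by rw [hc2 x h1, sub_self]
    rw [h2, add_zero, WithLp.toLp_eq_zero] at hx
    exact hg _ trivial hx
  · rw [hgc x (hc4 x (by linarith)), add_sub_cancel] at hx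
    rw [hx, norm_zero] at h1
    norm_num at h1

theorem indBelow_of_isInducing : ∀ (k : ℕ) {A X : Type u} [TopologicalSpace A]
    [TopologicalSpace X] {f : A → X}, IsInducing f → indBelow k X → indBelow k A := by
  intro k
  induction k with
  | zero =>
    intro A X _ _ f _ h
    have : IsEmpty X := h
    exact Function.isEmpty f
  | succ k ih =>
    intro A X _ _ f hf h x U hU hx
    obtain ⟨U', hU', rfl⟩ := hf.isOpen_iff.1 hU
    obtain ⟨V, hV, hxV, hVU, hk⟩ := h (f x) U' hU' hx
    refine ⟨f ⁻¹' V, hV.preimage hf.continuous, hxV, preimage_mono hVU, ?_⟩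
    have hfr : ∀ y : ↥(frontier (f ⁻¹' V)), f y ∈ frontier V :=
      fun y => hf.continuous.frontier_preimage_subset V y.2
    exact ih (f := fun y : ↥(frontier (f ⁻¹' V)) => (⟨f y, hfr y⟩ : ↥(frontier V)))
      ((hf.comp .subtypeVal).codRestrict hfr) hk

theorem indBelow_succ : ∀ (k : ℕ) {X : Type u} [TopologicalSpace X],
    indBelow k X → indBelow (k + 1) X := by
  intro k
  induction k with
  | zero =>
    intro X _ h x
    have : IsEmpty X := h
    exact isEmptyElim x
  | succ k ih =>
    intro X _ h x U hU hx
    obtain ⟨V, hV, hxV, hVU, hk⟩ := h x U hU hx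
    exact ⟨V, hV, hxV, hVU, ih hk⟩

theorem indBelow_mono {k m : ℕ} (h : k ≤ m) {X : Type u} [TopologicalSpace X]
    (hk : indBelow k X) : indBelow m X := by
  induction h with
  | refl => exact hk
  | step _ ih => exact indBelow_succ _ ih

theorem indDim_le_iff {n : ℕ} {X : Type u} [TopologicalSpace X] :
    indDim X ≤ (n : EReal) - 1 ↔ indBelow n X := by
  refine ⟨fun h => ?_, fun h => sInf_le ⟨n, h, rfl⟩⟩
  have hlt : indDim X < (n : EReal) := by
    refine h.trans_lt ?_
    have : ((n : ℝ) - 1 : EReal) < (n : ℝ) := by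
      rw [← EReal.coe_one, ← EReal.coe_sub, EReal.coe_lt_coe_iff]
      linarith
    exact this
  obtain ⟨_, ⟨m, hm, rfl⟩, hmn⟩ := sInf_lt_iff.1 hlt
  refine indBelow_mono ?_ hm
  have : (m : ℝ) - 1 < n := by
    have h1 : ((m : ℝ) - 1 : EReal) < (n : ℝ) := hmn
    rwa [← EReal.coe_one, ← EReal.coe_sub, EReal.coe_lt_coe_iff] at h1
  have : (m : ℝ) < ((n + 1 : ℕ) : ℝ) := by push_cast; linarith
  exact Nat.lt_succ_iff.1 (by exact_mod_cast this)

end InductiveDimension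

section Dimensions

open MeasureTheory

/-- At every scale `r ≤ 1`, the set `A` is covered by `O(r ^ (-a))` sets of diameter at most `r`. -/
def CoverBound {X : Type*} [MetricSpace X] (a : ℝ) (A : Set X) : Prop :=
  ∃ c : ℝ≥0, ∀ r : ℝ≥0, 0 < r → r ≤ 1 → ∃ (ι : Type) (_ : Fintype ι) (t : ι → Set X),
    (Fintype.card ι : ℝ≥0) ≤ c * r ^ (-a) ∧ A ⊆ ⋃ i, t i ∧ ∀ i, ediam (t i) ≤ r

/-- `U` has a countable cover of mesh at most `η` whose `s`-dimensional sum is at most `η`. -/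
def SmallCover {X : Type*} [MetricSpace X] (s : ℝ) (η : ℝ≥0∞) (U : Set X) : Prop :=
  ∃ (ι : Type) (_ : Countable ι) (t : ι → Set X),
    U ⊆ ⋃ i, t i ∧ (∀ i, ediam (t i) ≤ η) ∧ ∑' i, ediam (t i) ^ s ≤ η

section Cover

variable {X Y : Type*} [MetricSpace X] [MetricSpace Y]

theorem CoverBound.mono {a : ℝ} {A B : Set X} (hA : CoverBound a A) (h : B ⊆ A) :
    CoverBound a B := by
  obtain ⟨c, hc⟩ := hA
  refine ⟨c, fun r hr hr1 => ?_⟩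
  obtain ⟨ι, hι, t, h1, h2, h3⟩ := hc r hr hr1
  exact ⟨ι, hι, t, h1, h.trans h2, h3⟩

theorem CoverBound.mono_exponent {a b : ℝ} {A : Set X} (hA : CoverBound a A) (h : a ≤ b) :
    CoverBound b A := by
  obtain ⟨c, hc⟩ := hA
  refine ⟨c, fun r hr hr1 => ?_⟩
  obtain ⟨ι, hι, t, h1, h2, h3⟩ := hc r hr hr1
  refine ⟨ι, hι, t, h1.trans ?_, h2, h3⟩
  exact mul_le_mul_right (NNReal.rpow_le_rpow_of_exponent_ge hr hr1 (neg_le_neg h)) c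

theorem CoverBound.iUnion {κ : Type} [Fintype κ] {a : ℝ} {A : κ → Set X}
    (hA : ∀ k, CoverBound a (A k)) : CoverBound a (⋃ k, A k) := by
  choose c hc using hA
  refine ⟨∑ k, c k, fun r hr hr1 => ?_⟩
  choose ι hι t h1 h2 h3 using fun k => hc k r hr hr1
  refine ⟨Σ k, ι k, inferInstance, fun p => t p.1 p.2, ?_, ?_, fun p => h3 p.1 p.2⟩
  · rw [Fintype.card_sigma, Nat.cast_sum, Finset.sum_mul]
    exact Finset.sum_le_sum fun k _ => h1 k
  · refine iUnion_subset fun k x hx => ?_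
    obtain ⟨i, hi⟩ := mem_iUnion.1 (h2 k hx)
    exact mem_iUnion.2 ⟨⟨k, i⟩, hi⟩

theorem CoverBound.pi {κ : Type} [Fintype κ] {a : κ → ℝ} {A : κ → Set X}
    (hA : ∀ k, CoverBound (a k) (A k)) : CoverBound (∑ k, a k) (univ.pi A) := by
  classical
  choose c hc using hA
  refine ⟨∏ k, c k, fun r hr hr1 => ?_⟩
  choose ι hι t h1 h2 h3 using fun k => hc k r hr hr1
  refine ⟨∀ k, ι k, inferInstance, fun i => univ.pi fun k => t k (i k), ?_, ?_,
    fun i => ediam_pi_le_of_le fun k => h3 k (i k)⟩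
  · have hsum : r ^ (-∑ k, a k) = ∏ k, r ^ (-a k) := by
      rw [← Finset.sum_neg_distrib, ← NNReal.coe_inj]
      push_cast
      exact Real.rpow_sum_of_pos (NNReal.coe_pos.2 hr) _ _
    rw [Fintype.card_pi, Nat.cast_prod, hsum, ← Finset.prod_mul_distrib]
    exact Finset.prod_le_prod (fun _ _ => zero_le) fun k _ => h1 k
  · intro x hx
    choose i hi using fun k => mem_iUnion.1 (h2 k (hx k trivial))
    exact mem_iUnion.2 ⟨i, fun k _ => hi k⟩

theorem CoverBound.preimage {a : ℝ} {A : Set Y} (hA : CoverBound a A) {f : X → Y}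
    (hf : Isometry f) : CoverBound a (f ⁻¹' A) := by
  obtain ⟨c, hc⟩ := hA
  refine ⟨c, fun r hr hr1 => ?_⟩
  obtain ⟨ι, hι, t, h1, h2, h3⟩ := hc r hr hr1
  refine ⟨ι, hι, fun i => f ⁻¹' t i, h1, fun x hx => ?_, fun i => ?_⟩
  · simpa using h2 hx
  · rw [← hf.ediam_image]
    exact (ediam_mono (image_preimage_subset _ _)).trans (h3 i)

theorem coverBound_zero_of_finite {A : Set X} (hA : A.Finite) : CoverBound 0 A := by
  obtain ⟨n, f, -, rfl⟩ := hA.fin_param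
  rw [← iUnion_singleton_eq_range]
  refine CoverBound.iUnion fun k => ⟨1, fun r hr hr1 => ?_⟩
  exact ⟨Unit, inferInstance, fun _ => {f k}, by simp, by simp, fun _ => by simp⟩

theorem coverBound_one_Icc (a b : ℝ) : CoverBound 1 (Icc a b) := by
  refine ⟨(b - a).toNNReal + 1, fun r hr hr1 => ⟨Fin (⌊(b - a).toNNReal / r⌋₊ + 1), inferInstance,
    fun i => Icc (a + i * r) (a + (i + 1) * r), ?_, fun x hx => ?_, fun i => ?_⟩⟩
  · rw [Fintype.card_fin, NNReal.rpow_neg, NNReal.rpow_one, add_mul, one_mul, Nat.cast_add,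
      Nat.cast_one, ← div_eq_mul_inv]
    exact add_le_add (Nat.floor_le zero_le) ((one_le_inv₀ hr).2 hr1)
  · have hr' : (0 : ℝ) < r := hr
    have h0 : 0 ≤ (x - a) / r := div_nonneg (sub_nonneg.2 hx.1) hr'.le
    have h1 : ⌊(x - a) / r⌋₊ < ⌊(b - a).toNNReal / r⌋₊ + 1 := by
      rw [Nat.lt_succ_iff]
      refine Nat.le_floor ?_
      rw [← NNReal.coe_le_coe]
      push_cast
      rw [Real.coe_toNNReal _ (sub_nonneg.2 (hx.1.trans hx.2))]
      exact (Nat.floor_le h0).trans (by gcongr; exact hx.2)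
    have h2 := Nat.floor_le h0
    have h3 := Nat.lt_floor_add_one ((x - a) / r)
    rw [le_div_iff₀ hr'] at h2
    rw [div_lt_iff₀ hr'] at h3
    exact mem_iUnion.2 ⟨⟨_, h1⟩, by simp only; constructor <;> linarith⟩
  · rw [Real.ediam_Icc]
    ring_nf
    simp

theorem SmallCover.mono {X : Type*} [MetricSpace X] {s : ℝ} {η δ : ℝ≥0∞} {A U : Set X}
    (hU : SmallCover s η U) (hA : A ⊆ U) (hη : η ≤ δ) : SmallCover s δ A := by
  obtain ⟨ι, hι, t, h1, h2, h3⟩ := hU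
  exact ⟨ι, hι, t, hA.trans h1, fun i => (h2 i).trans hη, h3.trans hη⟩

theorem SmallCover.iUnion {s : ℝ} {κ : Type} [Countable κ] {η : κ → ℝ≥0∞} {δ : ℝ≥0∞}
    {U : κ → Set X} (hU : ∀ k, SmallCover s (η k) (U k)) (h : ∑' k, η k ≤ δ) :
    SmallCover s δ (⋃ k, U k) := by
  choose ι hι t h1 h2 h3 using hU
  refine ⟨Σ k, ι k, inferInstance, fun p => t p.1 p.2, ?_, fun p => ?_, ?_⟩
  · refine iUnion_subset fun k x hx => ?_
    obtain ⟨i, hi⟩ := mem_iUnion.1 (h1 k hx)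
    exact mem_iUnion.2 ⟨⟨k, i⟩, hi⟩
  · exact (h2 p.1 p.2).trans ((ENNReal.le_tsum p.1).trans h)
  · rw [ENNReal.tsum_sigma fun k i => ediam (t k i) ^ s]
    exact (ENNReal.tsum_le_tsum h3).trans h

theorem exists_isOpen_smallCover_iUnion {s : ℝ} {κ : Type} [Countable κ] {A : κ → Set X}
    (hA : ∀ k, ∀ η : ℝ≥0∞, 0 < η → ∃ U, IsOpen U ∧ A k ⊆ U ∧ SmallCover s η U)
    {η : ℝ≥0∞} (hη : 0 < η) : ∃ U, IsOpen U ∧ ⋃ k, A k ⊆ U ∧ SmallCover s η U := by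
  obtain ⟨ε, hε, hεη⟩ := ENNReal.exists_pos_sum_of_countable' hη.ne' κ
  choose U hUo hAU hU using fun k => hA k (ε k) (hε k)
  exact ⟨⋃ k, U k, isOpen_iUnion hUo, iUnion_mono hAU, SmallCover.iUnion hU hεη.le⟩

theorem dimH_le_of_forall_smallCover {s : ℝ≥0} {A : Set X}
    (hA : ∀ η : ℝ≥0∞, 0 < η → SmallCover s η A) : dimH A ≤ s := by
  borelize X
  have hpos : ∀ n : ℕ, 0 < ((n : ℝ≥0∞) + 1)⁻¹ := fun n =>
    ENNReal.inv_pos.2 (by finiteness)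
  have hlim : Tendsto (fun n : ℕ => ((n : ℝ≥0∞) + 1)⁻¹) atTop (𝓝 0) := by
    have := (tendsto_add_atTop_iff_nat 1).2 ENNReal.tendsto_inv_nat_nhds_zero
    simpa using this
  choose ι hι t h1 h2 h3 using fun n => hA _ (hpos n)
  have h := Measure.hausdorffMeasure_le_liminf_tsum (s : ℝ) A _ hlim t (.of_forall h2)
    (.of_forall h1)
  have h0 : liminf (fun n => ∑' i, ediam (t n i) ^ (s : ℝ)) atTop = 0 :=
    (tendsto_of_tendsto_of_tendsto_of_le_of_le tendsto_const_nhds hlim (fun _ => zero_le)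
      h3).liminf_eq
  refine dimH_le_of_hausdorffMeasure_ne_top ?_
  rw [h0] at h
  exact (h.trans_lt ENNReal.zero_lt_top).ne

theorem CoverBound.exists_isOpen_smallCover {a s : ℝ} {A : Set X} (hA : CoverBound a A)
    (hs : 0 < s) (has : a < s) {η : ℝ≥0∞} (hη : 0 < η) :
    ∃ U, IsOpen U ∧ A ⊆ U ∧ SmallCover s η U := by
  obtain ⟨c, hc⟩ := hA
  have hlim : Tendsto (fun r : ℝ≥0 => c * 3 ^ s * r ^ (s - a)) (𝓝[>] 0) (𝓝 0) := by
    have h : Continuous fun r : ℝ≥0 => c * 3 ^ s * r ^ (s - a) :=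
      continuous_const.mul (NNReal.continuous_rpow_const (sub_pos.2 has).le)
    have := h.tendsto 0
    rw [NNReal.zero_rpow (sub_pos.2 has).ne', mul_zero] at this
    exact this.mono_left nhdsWithin_le_nhds
  have hlim' : Tendsto (fun r : ℝ≥0 => ((c * 3 ^ s * r ^ (s - a) : ℝ≥0) : ℝ≥0∞)) (𝓝[>] 0)
      (𝓝 0) := ENNReal.tendsto_coe.2 hlim
  have hlim3 : Tendsto (fun r : ℝ≥0 => ((3 * r : ℝ≥0) : ℝ≥0∞)) (𝓝[>] 0) (𝓝 0) := by
    have h : Continuous fun r : ℝ≥0 => 3 * r := by fun_prop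
    have := h.tendsto 0
    rw [mul_zero] at this
    exact ENNReal.tendsto_coe.2 (this.mono_left nhdsWithin_le_nhds)
  have hpos : ∀ᶠ r : ℝ≥0 in 𝓝[>] 0, 0 < r := self_mem_nhdsWithin
  have hone : ∀ᶠ r : ℝ≥0 in 𝓝[>] 0, r < 1 :=
    nhdsWithin_le_nhds (isOpen_Iio.mem_nhds (mem_Iio.2 zero_lt_one))
  obtain ⟨r, h1, h2, hr, hr1⟩ := ((hlim'.eventually_lt_const hη).and
    ((hlim3.eventually_lt_const hη).and (hpos.and hone))).exists
  obtain ⟨ι, hι, t, hcard, hAt, ht⟩ := hc r hr hr1.le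
  have hd : ∀ i, ediam (thickening r (t i)) ≤ ((3 * r : ℝ≥0) : ℝ≥0∞) := fun i => by
    refine (ediam_thickening_le r).trans ?_
    calc ediam (t i) + 2 * (r : ℝ≥0∞) ≤ r + 2 * r := by gcongr; exact ht i
      _ = ((3 * r : ℝ≥0) : ℝ≥0∞) := by push_cast; ring
  refine ⟨⋃ i, thickening r (t i), isOpen_iUnion fun i => isOpen_thickening,
    hAt.trans (iUnion_mono fun i => self_subset_thickening hr _), ι, inferInstance,
    fun i => thickening r (t i), Subset.rfl, fun i => (hd i).trans h2.le, ?_⟩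
  calc ∑' i, ediam (thickening r (t i)) ^ s
      ≤ ∑' _ : ι, (((3 * r) ^ s : ℝ≥0) : ℝ≥0∞) := ENNReal.tsum_le_tsum fun i => by
        rw [ENNReal.coe_rpow_of_nonneg _ hs.le]
        exact ENNReal.rpow_le_rpow (hd i) hs.le
    _ = ((Fintype.card ι * (3 * r) ^ s : ℝ≥0) : ℝ≥0∞) := by
        rw [tsum_fintype, Finset.sum_const, nsmul_eq_mul]
        push_cast
        rfl
    _ ≤ ((c * 3 ^ s * r ^ (s - a) : ℝ≥0) : ℝ≥0∞) := by
        rw [ENNReal.coe_le_coe]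
        calc (Fintype.card ι * (3 * r) ^ s : ℝ≥0) ≤ c * r ^ (-a) * (3 * r) ^ s := by gcongr
          _ = c * 3 ^ s * r ^ (s - a) := by
            rw [NNReal.mul_rpow, sub_eq_add_neg, NNReal.rpow_add hr.ne']
            ring
    _ ≤ η := h1.le

end Cover

section Packing

variable {X : Type*} [MetricSpace X]

theorem packPre0_empty (h : ℝ≥0 → ℝ≥0) : packPre0 h (∅ : Set X) = 0 := by
  refine le_antisymm (iInf₂_le_of_le 1 one_pos (iSup₂_le fun s hs => ?_)) zero_le
  have : IsEmpty s := ⟨fun p => (hs.2.1 p p.2).1⟩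
  simp

theorem packMeasure_le_packPre0 (h : ℝ≥0 → ℝ≥0) (A : Set X) :
    packMeasure h A ≤ packPre0 h A := by
  refine iInf₂_le_of_le (fun i => if i = 0 then A else ∅) ?_ ?_
  · ext x
    simp
  · rw [tsum_eq_single 0 fun i hi => by simp [hi, packPre0_empty]]
    simp

theorem CoverBound.packPre_lt_top {a : ℝ} {A : Set X} (hA : CoverBound a A) {s : ℝ}
    (hs : 0 < s) (has : a < s) : packPre (fun r => r ^ s) A 1 < ∞ := by
  obtain ⟨c, hc⟩ := hA
  have h2 : (0 : ℝ≥0) < 2⁻¹ := by positivity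
  have h2' : (2⁻¹ : ℝ≥0) < 1 := two_inv_lt_one
  choose ι hι t hcard hAt ht using fun j : ℕ =>
    hc (2⁻¹ ^ (j + 1)) (pow_pos h2 _) (pow_le_one₀ h2.le h2'.le)
  have key : packPre (fun r => r ^ s) A 1 ≤
      ∑' j : ℕ, ((Fintype.card (ι j) * (2⁻¹ ^ j) ^ s : ℝ≥0) : ℝ≥0∞) := by
    refine iSup₂_le fun S hS => ?_
    let L : ℕ → Set S := fun j => {p | 2⁻¹ ^ (j + 1) < p.1.2 ∧ p.1.2 ≤ 2⁻¹ ^ j}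
    have hpt : ∀ p : S, ((p.1.2 ^ s : ℝ≥0) : ℝ≥0∞) ≤
        ∑' j, (L j).indicator (fun _ => (((2⁻¹ ^ j) ^ s : ℝ≥0) : ℝ≥0∞)) p := fun p => by
      rcases (zero_le (a := p.1.2)).eq_or_lt with h | h
      · rw [← h, NNReal.zero_rpow hs.ne']
        exact zero_le
      · obtain ⟨j, hj⟩ := exists_nat_pow_near_of_lt_one h (hS.2.1 p p.2).2 h2 h2'
        refine le_trans ?_ (ENNReal.le_tsum j)
        rw [indicator_of_mem (show p ∈ L j from hj), ENNReal.coe_le_coe]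
        exact NNReal.rpow_le_rpow hj.2 hs.le
    refine (ENNReal.tsum_le_tsum hpt).trans ?_
    rw [ENNReal.tsum_comm]
    refine ENNReal.tsum_le_tsum fun j => ?_
    rw [← tsum_subtype (L j) fun _ => (((2⁻¹ ^ j) ^ s : ℝ≥0) : ℝ≥0∞)]
    choose i hi using fun p : S => mem_iUnion.1 (hAt j (hS.2.1 p p.2).1)
    have hinj : Function.Injective fun p : L j => i p.1 := by
      intro p q hpq
      by_contra hne
      have hd : Disjoint (closedBall p.1.1.1 (p.1.1.2 : ℝ)) (closedBall q.1.1.1 (q.1.1.2 : ℝ)) :=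
        hS.2.2 p.1.2 q.1.2 fun h => hne (Subtype.ext (Subtype.ext h))
      have hdist : dist q.1.1.1 p.1.1.1 ≤ p.1.1.2 := by
        have h3 : edist q.1.1.1 p.1.1.1 ≤ ((2⁻¹ ^ (j + 1) : ℝ≥0) : ℝ≥0∞) := by
          refine (edist_le_ediam_of_mem (hi q.1) ?_).trans (ht j _)
          have := hi p.1
          rwa [show i p.1 = i q.1 from hpq] at this
        rw [edist_nndist, ENNReal.coe_le_coe] at h3
        exact_mod_cast h3.trans p.2.1.le
      exact disjoint_left.1 hd (mem_closedBall.2 hdist) (mem_closedBall_self q.1.1.2.2)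
    calc ∑' _ : L j, (((2⁻¹ ^ j) ^ s : ℝ≥0) : ℝ≥0∞)
        ≤ ∑' _ : ι j, (((2⁻¹ ^ j) ^ s : ℝ≥0) : ℝ≥0∞) :=
          ENNReal.tsum_comp_le_tsum_of_injective hinj fun _ => (((2⁻¹ ^ j) ^ s : ℝ≥0) : ℝ≥0∞)
      _ = ((Fintype.card (ι j) * (2⁻¹ ^ j) ^ s : ℝ≥0) : ℝ≥0∞) := by
          rw [tsum_fintype, Finset.sum_const, nsmul_eq_mul]
          push_cast
          rfl
  refine key.trans_lt ?_
  have hb : ∀ j : ℕ, (Fintype.card (ι j) * (2⁻¹ ^ j) ^ s : ℝ≥0) ≤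
      c * 2⁻¹ ^ (-a) * (2⁻¹ ^ (s - a)) ^ j := fun j => by
    calc (Fintype.card (ι j) * (2⁻¹ ^ j) ^ s : ℝ≥0)
        ≤ c * (2⁻¹ ^ (j + 1)) ^ (-a) * (2⁻¹ ^ j) ^ s := by gcongr; exact hcard j
      _ = c * 2⁻¹ ^ (-a) * (2⁻¹ ^ (s - a)) ^ j := by
        rw [pow_succ, NNReal.mul_rpow, ← NNReal.rpow_natCast (2⁻¹ ^ (s - a)), ← NNReal.rpow_mul,
          mul_comm (s - a), NNReal.rpow_mul, sub_eq_add_neg, NNReal.rpow_natCast,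
          NNReal.rpow_add (pow_pos h2 j).ne']
        ring
  have hlt : (2⁻¹ : ℝ≥0) ^ (s - a) < 1 := NNReal.rpow_lt_one h2' (sub_pos.2 has)
  have hsum : Summable fun j : ℕ => c * 2⁻¹ ^ (-a) * ((2⁻¹ : ℝ≥0) ^ (s - a)) ^ j :=
    (NNReal.summable_geometric hlt).mul_left _
  exact lt_of_le_of_lt (ENNReal.tsum_le_tsum fun j => ENNReal.coe_le_coe.2 (hb j))
    (lt_top_iff_ne_top.2 (ENNReal.tsum_coe_ne_top_iff_summable.2 hsum))

theorem CoverBound.pdim_le {a : ℝ} {A : Set X} (hA : CoverBound a A) (ha : 0 ≤ a) :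
    pdim A ≤ a := by
  have ha' : (0 : EReal) ≤ a := EReal.coe_nonneg.2 ha
  unfold pdim
  split_ifs with h
  · exact (EReal.neg_le.2 (by simp)).trans ha'
  · refine max_le ha' (iSup₂_le fun s hs => EReal.coe_le_coe_iff.2 ?_)
    by_contra! has
    have := hA.packPre_lt_top (ha.trans_lt has) has
    refine ((packMeasure_le_packPre0 _ A).trans_lt ?_).ne hs
    exact (iInf₂_le 1 one_pos).trans_lt this

/-- A set whose closure contains large separated families at all small scales has infinite
packing premeasure. -/
theorem packPre0_eq_top {s : ℝ} {A : Set X}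
    (hA : ∀ δ : ℝ≥0, 0 < δ → ∀ M : ℝ≥0, ∃ r : ℝ≥0, 0 < r ∧ r ≤ δ ∧ ∃ T : Finset X,
      (T : Set X) ⊆ closure A ∧ (∀ x ∈ T, ∀ y ∈ T, x ≠ y → 4 * (r : ℝ) ≤ dist x y) ∧
      M ≤ T.card * r ^ s) :
    packPre0 (fun r => r ^ s) A = ∞ := by
  refine iInf₂_eq_top.2 fun δ hδ => ENNReal.eq_top_of_forall_nnreal_le fun M => ?_
  obtain ⟨r, hr, hrδ, T, hTA, hT, hM⟩ := hA δ hδ M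
  have hr' : (0 : ℝ) < r := hr
  choose b hbA hb using fun x : T => Metric.mem_closure_iff.1 (hTA x.2) r hr'
  have hsep : ∀ x y : T, x ≠ y →
      Disjoint (closedBall (b x) (r : ℝ)) (closedBall (b y) (r : ℝ)) := fun x y hxy => by
    refine disjoint_left.2 fun z hz hz' => ?_
    have h1 := hT x x.2 y y.2 fun h => hxy (Subtype.ext h)
    have h2 := dist_triangle4 (x : X) (b x) (b y) y
    have h3 := dist_triangle (b x) z (b y)
    rw [mem_closedBall, dist_comm] at hz
    rw [mem_closedBall] at hz'
    have h4 := hb x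
    have h5 := hb y
    rw [dist_comm] at h5
    linarith
  have hinj : Function.Injective fun x : T => (b x, r) := fun x y hxy => by
    by_contra hne
    have h1 := hsep x y hne
    rw [show b x = b y from congrArg Prod.fst hxy] at h1
    exact disjoint_left.1 h1 (mem_closedBall_self hr'.le) (mem_closedBall_self hr'.le)
  refine le_trans ?_ (le_iSup₂_of_le (range fun x : T => (b x, r))
    ⟨countable_range _, ?_, ?_⟩ le_rfl)
  · rw [tsum_range (fun p : X × ℝ≥0 => ((p.2 ^ s : ℝ≥0) : ℝ≥0∞)) hinj]
    simp only [tsum_fintype, Finset.sum_const, Finset.card_univ, Fintype.card_coe, nsmul_eq_mul]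
    exact_mod_cast hM
  · rintro _ ⟨x, rfl⟩
    exact ⟨hbA x, hrδ⟩
  · rintro _ ⟨x, rfl⟩ _ ⟨y, rfl⟩ hne
    exact hsep x y fun h => hne (by rw [h])

theorem le_pdim {s : ℝ≥0} {A : Set X} (hA : A.Nonempty)
    (h : ∀ c : ℕ → Set X, A = ⋃ i, c i → ∃ i, packPre0 (fun r => r ^ (s : ℝ)) (c i) = ∞) :
    ((s : ℝ) : EReal) ≤ pdim A := by
  rw [pdim, if_neg hA.ne_empty]
  refine le_max_of_le_right (le_iSup₂_of_le s ?_ le_rfl)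
  refine iInf₂_eq_top.2 fun c hc => ?_
  obtain ⟨i, hi⟩ := h c hc
  exact top_le_iff.1 (hi ▸ ENNReal.le_tsum i)

end Packing

/-- `g` codes a self-similar Cantor set of ratio `q`: two codes which first differ at place `k`
have images at distance comparable to `q ^ k`. -/
structure IsCantorCoding (q κ : ℝ) (g : (ℕ → Fin 2) → ℝ) : Prop where
  pos : 0 < κ
  dist_le : ∀ k ε δ, (∀ i < k, ε i = δ i) → |g ε - g δ| ≤ q ^ k
  le_dist : ∀ k ε δ, (∀ i < k, ε i = δ i) → ε k ≠ δ k → κ * q ^ k ≤ |g ε - g δ|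

namespace IsCantorCoding

variable {q κ s : ℝ} {g : (ℕ → Fin 2) → ℝ}

theorem exists_first_ne {ε δ : ℕ → Fin 2} (h : ε ≠ δ) :
    ∃ k, (∀ i < k, ε i = δ i) ∧ ε k ≠ δ k := by
  classical
  have h' := Function.ne_iff.1 h
  exact ⟨Nat.find h', fun i hi => not_not.1 (Nat.find_min h' hi), Nat.find_spec h'⟩

theorem injective (hg : IsCantorCoding q κ g) (hq : 0 < q) : Function.Injective g := by
  intro ε δ h
  by_contra hne
  obtain ⟨k, hk, hk'⟩ := exists_first_ne hne
  have := hg.le_dist k ε δ hk hk'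
  rw [h, sub_self, abs_zero] at this
  exact this.not_gt (mul_pos hg.pos (pow_pos hq k))

theorem pow_rpow (hq : 0 < q) (hqs : q ^ s = 2⁻¹) (k : ℕ) : (q ^ k) ^ s = 2⁻¹ ^ k := by
  rw [← Real.rpow_natCast, ← Real.rpow_mul hq.le, mul_comm, Real.rpow_mul hq.le, hqs,
    Real.rpow_natCast]

theorem coverBound_range (hg : IsCantorCoding q κ g) (hq : 0 < q) (hq1 : q < 1)
    (hqs : q ^ s = 2⁻¹) : CoverBound s (range g) := by
  have hs : 0 ≤ s := by
    by_contra! h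
    have := Real.one_le_rpow_of_pos_of_le_one_of_nonpos hq hq1.le h.le
    rw [hqs] at this
    norm_num at this
  refine ⟨2, fun r hr hr1 => ?_⟩
  obtain ⟨k, hk1, hk2⟩ := exists_nat_pow_near_of_lt_one (NNReal.coe_pos.2 hr) hr1 hq hq1
  refine ⟨Fin (k + 1) → Fin 2, inferInstance, fun a => g '' {ε | ∀ i : Fin (k + 1), ε i = a i},
    ?_, ?_, fun a => ?_⟩
  · rw [← NNReal.coe_le_coe, Fintype.card_pi]
    push_cast
    simp only [Fintype.card_fin, Nat.cast_ofNat, Finset.prod_const, Finset.card_univ]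
    rw [Real.rpow_neg r.coe_nonneg, pow_succ']
    gcongr
    rw [← inv_inv ((2 : ℝ) ^ k), ← inv_pow, ← pow_rpow hq hqs k]
    refine inv_anti₀ (Real.rpow_pos_of_pos hr s) ?_
    exact Real.rpow_le_rpow r.coe_nonneg hk2 hs
  · rintro _ ⟨ε, rfl⟩
    exact mem_iUnion.2 ⟨fun i => ε i, ε, fun _ => rfl, rfl⟩
  · refine ediam_le ?_
    rintro _ ⟨ε, hε, rfl⟩ _ ⟨δ, hδ, rfl⟩
    rw [edist_dist, Real.dist_eq]
    have h := hg.dist_le (k + 1) ε δ fun i hi => (hε ⟨i, hi⟩).trans (hδ ⟨i, hi⟩).symm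
    exact ENNReal.ofReal_le_of_le_toReal (h.trans hk1.le)

theorem le_dimH_range (hg : IsCantorCoding q κ g) (hq : 0 < q) {s : ℝ≥0} (hs : 0 < s)
    (hqs : q ^ (s : ℝ) = 2⁻¹) : (s : ℝ≥0∞) ≤ dimH (range g) := by
  have hs' : (0 : ℝ) < s := hs
  let f : ℝ → ℝ := fun x => Real.ofDigits (b := 2) (Function.invFun g x)
  have hf : ∀ ε, f (g ε) = Real.ofDigits ε := fun ε =>
    congrArg Real.ofDigits (Function.leftInverse_invFun (hg.injective hq) ε)
  have hC : 0 ≤ (κ ^ (s : ℝ))⁻¹ := by have := hg.pos; positivity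
  have hH : HolderOnWith (κ ^ (s : ℝ))⁻¹.toNNReal s f (range g) := by
    rintro _ ⟨ε, rfl⟩ _ ⟨δ, rfl⟩
    rcases eq_or_ne ε δ with rfl | hne
    · simp
    obtain ⟨k, hk, hk'⟩ := exists_first_ne hne
    have h1 := Real.abs_ofDigits_sub_ofDigits_le hk
    have h2 := hg.le_dist k ε δ hk hk'
    rw [hf, hf, edist_dist, edist_dist, Real.dist_eq, Real.dist_eq,
      ENNReal.ofReal_rpow_of_nonneg (abs_nonneg _) hs'.le,
      show ((κ ^ (s : ℝ))⁻¹.toNNReal : ℝ≥0∞) = ENNReal.ofReal (κ ^ (s : ℝ))⁻¹ from rfl,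
        ← ENNReal.ofReal_mul hC]
    refine ENNReal.ofReal_le_ofReal (h1.trans ?_)
    have h3 : (κ * q ^ k) ^ (s : ℝ) ≤ |g ε - g δ| ^ (s : ℝ) :=
      Real.rpow_le_rpow (mul_nonneg hg.pos.le (pow_pos hq k).le) h2 hs'.le
    rw [Real.mul_rpow hg.pos.le (pow_pos hq k).le, pow_rpow hq hqs] at h3
    have h4 : 0 < κ ^ (s : ℝ) := Real.rpow_pos_of_pos hg.pos _
    rw [inv_mul_eq_div, le_div_iff₀ h4, mul_comm]
    simpa using h3
  have h1 := hH.dimH_image_le hs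
  have h2 : Icc (0 : ℝ) 1 ⊆ f '' range g := fun x hx => by
    obtain ⟨ε, -, rfl⟩ := Real.ofDigits_SurjOn one_lt_two hx
    exact ⟨g ε, ⟨ε, rfl⟩, hf ε⟩
  have h3 : dimH (Icc (0 : ℝ) 1) = 1 := by
    have h : Icc (0 : ℝ) 1 ∈ 𝓝 (1 / 2 : ℝ) := Icc_mem_nhds (by norm_num) (by norm_num)
    rw [Real.dimH_of_mem_nhds h, Module.finrank_self, Nat.cast_one]
  have h4 := (h3 ▸ dimH_mono h2).trans h1
  rw [ENNReal.le_div_iff_mul_le (by simp [hs.ne']) (by simp), one_mul] at h4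
  exact h4

theorem exists_separated (hg : IsCantorCoding q κ g) (hq : 0 < q) (hq1 : q < 1) {x : ℝ}
    (hx : x ∈ range g) {ρ : ℝ} (hρ : 0 < ρ) : ∃ c > 0, ∀ j : ℕ, ∃ T : Finset ℝ,
      (∀ y ∈ T, y ∈ range g ∧ |y - x| ≤ ρ) ∧ T.card = 2 ^ j ∧
      ∀ y ∈ T, ∀ z ∈ T, y ≠ z → c * q ^ j ≤ |y - z| := by
  obtain ⟨ε, rfl⟩ := hx
  obtain ⟨k, hk⟩ := exists_pow_lt_of_lt_one hρ hq1
  refine ⟨κ * q ^ k, mul_pos hg.pos (pow_pos hq k), fun j => ?_⟩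
  let e : (Fin j → Fin 2) → ℕ → Fin 2 := fun a i =>
    if h : k ≤ i ∧ i - k < j then a ⟨i - k, h.2⟩ else ε i
  have he : Function.Injective e := fun a b hab => funext fun i => by
    have h : k ≤ k + i ∧ k + i - k < j := ⟨by omega, by omega⟩
    have := congrFun hab (k + i)
    simpa [e, h] using this
  have hek : ∀ a, ∀ i < k, e a i = ε i := fun a i hi => dif_neg fun h => by omega
  have hinj := (hg.injective hq).comp he
  refine ⟨Finset.univ.map ⟨g ∘ e, hinj⟩, ?_, ?_, ?_⟩
  · simp only [Finset.mem_map, Finset.mem_univ, true_and]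
    rintro _ ⟨a, rfl⟩
    exact ⟨⟨e a, rfl⟩, (hg.dist_le k _ _ (hek a)).trans hk.le⟩
  · simp
  · simp only [Finset.mem_map, Finset.mem_univ, true_and]
    rintro _ ⟨a, rfl⟩ _ ⟨b, rfl⟩ hne
    have hne' : e a ≠ e b := fun h => hne (by simp [h])
    obtain ⟨i, hi, hi'⟩ := exists_first_ne hne'
    have hij : i < k + j := by
      by_contra! h
      have h1 : ¬ (k ≤ i ∧ i - k < j) := fun h' => by omega
      simp [e, h1] at hi'
    refine le_trans ?_ (hg.le_dist i _ _ hi hi')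
    rw [mul_assoc, ← pow_add]
    exact mul_le_mul_of_nonneg_left (pow_le_pow_of_le_one hq.le hq1.le hij.le) hg.pos.le

end IsCantorCoding

section CantorSeries

/-- The sum of the subseries of the geometric series of ratio `q` selected by `ε`. -/
noncomputable def cantorSeries (q : ℝ) (ε : ℕ → Fin 2) : ℝ := ∑' k, (ε k : ℝ) * q ^ k

variable {q : ℝ}

theorem digit_mul_pow_le (hq : 0 ≤ q) (ε : ℕ → Fin 2) (k : ℕ) : (ε k : ℝ) * q ^ k ≤ q ^ k := by
  have : ((ε k : ℕ) : ℝ) ≤ 1 := by exact_mod_cast Nat.lt_succ_iff.1 (ε k).2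
  exact mul_le_of_le_one_left (pow_nonneg hq k) this

theorem digit_mul_pow_nonneg (hq : 0 ≤ q) (ε : ℕ → Fin 2) (k : ℕ) : 0 ≤ (ε k : ℝ) * q ^ k :=
  mul_nonneg (Nat.cast_nonneg _) (pow_nonneg hq k)

theorem summable_cantorSeries (hq : 0 ≤ q) (hq1 : q < 1) (ε : ℕ → Fin 2) :
    Summable fun k => (ε k : ℝ) * q ^ k :=
  .of_nonneg_of_le (digit_mul_pow_nonneg hq ε) (digit_mul_pow_le hq ε)
    (summable_geometric_of_lt_one hq hq1)

theorem cantorSeries_nonneg (hq : 0 ≤ q) (ε : ℕ → Fin 2) : 0 ≤ cantorSeries q ε :=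
  tsum_nonneg (digit_mul_pow_nonneg hq ε)

theorem cantorSeries_le (hq : 0 ≤ q) (hq2 : q < 1 / 2) (ε : ℕ → Fin 2) :
    cantorSeries q ε ≤ 2 := by
  have hq1 : q < 1 := by linarith
  calc cantorSeries q ε ≤ ∑' k, q ^ k :=
        (summable_cantorSeries hq hq1 ε).tsum_le_tsum (digit_mul_pow_le hq ε)
          (summable_geometric_of_lt_one hq hq1)
    _ = (1 - q)⁻¹ := tsum_geometric_of_lt_one hq hq1
    _ ≤ 2 := by
      rw [inv_le_comm₀ (by linarith) two_pos]
      linarith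

theorem cantorSeries_sub (hq : 0 ≤ q) (hq1 : q < 1) {ε δ : ℕ → Fin 2} {k : ℕ}
    (h : ∀ i < k, ε i = δ i) : cantorSeries q ε - cantorSeries q δ =
      q ^ k * (cantorSeries q (fun i => ε (i + k)) - cantorSeries q fun i => δ (i + k)) := by
  have key : ∀ ε : ℕ → Fin 2, cantorSeries q ε = ∑ i ∈ Finset.range k, (ε i : ℝ) * q ^ i +
      q ^ k * cantorSeries q fun i => ε (i + k) := fun ε => by
    rw [cantorSeries, ← (summable_cantorSeries hq hq1 ε).sum_add_tsum_nat_add k, cantorSeries,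
      ← tsum_mul_left]
    congr 2
    funext i
    ring
  have hsum : ∑ i ∈ Finset.range k, (ε i : ℝ) * q ^ i = ∑ i ∈ Finset.range k, (δ i : ℝ) * q ^ i :=
    Finset.sum_congr rfl fun i hi => by rw [h i (Finset.mem_range.1 hi)]
  rw [key ε, key δ, hsum]
  ring

theorem cantorSeries_eq_add (hq : 0 ≤ q) (hq1 : q < 1) (ε : ℕ → Fin 2) :
    cantorSeries q ε = ε 0 + q * cantorSeries q fun i => ε (i + 1) := by
  rw [cantorSeries, (summable_cantorSeries hq hq1 ε).tsum_eq_zero_add, cantorSeries,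
    ← tsum_mul_left, pow_zero, mul_one]
  congr 2
  funext i
  ring

theorem abs_cantorSeries_sub_le (hq : 0 ≤ q) (hq2 : q < 1 / 2) {ε δ : ℕ → Fin 2} {k : ℕ}
    (h : ∀ i < k, ε i = δ i) : |cantorSeries q ε - cantorSeries q δ| ≤ 2 * q ^ k := by
  rw [cantorSeries_sub hq (by linarith) h, abs_mul, abs_of_nonneg (pow_nonneg hq k), mul_comm]
  refine mul_le_mul_of_nonneg_right (abs_le.2 ?_) (pow_nonneg hq k)
  constructor <;> linarith [cantorSeries_nonneg hq fun i => ε (i + k),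
    cantorSeries_nonneg hq fun i => δ (i + k), cantorSeries_le hq hq2 fun i => ε (i + k),
    cantorSeries_le hq hq2 fun i => δ (i + k)]

theorem le_abs_cantorSeries_sub (hq : 0 ≤ q) (hq2 : q < 1 / 2) {ε δ : ℕ → Fin 2} {k : ℕ}
    (h : ∀ i < k, ε i = δ i) (hk : ε k ≠ δ k) :
    (1 - 2 * q) * q ^ k ≤ |cantorSeries q ε - cantorSeries q δ| := by
  have hq1 : q < 1 := by linarith
  rw [cantorSeries_sub hq hq1 h, abs_mul, abs_of_nonneg (pow_nonneg hq k), mul_comm]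
  refine mul_le_mul_of_nonneg_left ?_ (pow_nonneg hq k)
  rw [cantorSeries_eq_add hq hq1, cantorSeries_eq_add hq hq1 fun i => δ (i + k)]
  simp only [zero_add]
  generalize hε : (fun i => ε (i + 1 + k)) = ε'
  generalize hδ : (fun i => δ (i + 1 + k)) = δ'
  have h1 := mul_nonneg hq (cantorSeries_nonneg hq ε')
  have h2 := mul_nonneg hq (cantorSeries_nonneg hq δ')
  have h3 := mul_le_mul_of_nonneg_left (cantorSeries_le hq hq2 ε') hq
  have h4 := mul_le_mul_of_nonneg_left (cantorSeries_le hq hq2 δ') hq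
  generalize ε k = a at *
  generalize δ k = b at *
  have h5 : (a = 0 ∧ b = 1) ∨ (a = 1 ∧ b = 0) := by
    fin_cases a <;> fin_cases b <;> simp at hk ⊢
  rcases h5 with ⟨rfl, rfl⟩ | ⟨rfl, rfl⟩
  · refine le_abs.2 (.inr ?_)
    simp
    linarith
  · refine le_abs.2 (.inl ?_)
    simp
    linarith

theorem continuous_cantorSeries (hq : 0 ≤ q) (hq1 : q < 1) : Continuous (cantorSeries q) := by
  refine continuous_tsum (u := fun k => q ^ k) (fun k => ?_) (summable_geometric_of_lt_one hq hq1)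
    fun k ε => ?_
  · have : Continuous fun a : Fin 2 => (a : ℝ) := continuous_of_discreteTopology
    exact (this.comp (continuous_apply k)).mul continuous_const
  · rw [Real.norm_of_nonneg (digit_mul_pow_nonneg hq ε k)]
    exact digit_mul_pow_le hq ε k

end CantorSeries

section TimeSet

/-- The dimension of the `m`-th Cantor set. -/
noncomputable def levelDim (m : ℕ) : ℝ := 1 - 1 / (m + 2)

/-- The contraction ratio of the `m`-th Cantor set. -/
noncomputable def levelRatio (m : ℕ) : ℝ := 2⁻¹ ^ (1 / levelDim m)

/-- The coding of the `m`-th Cantor set, which lies in `[2⁻ᵐ, (3 / 2) 2⁻ᵐ]`. -/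
noncomputable def levelCode (m : ℕ) (ε : ℕ → Fin 2) : ℝ :=
  2⁻¹ ^ m * (1 + cantorSeries (levelRatio m) ε / 4)

/-- The compact set of times: a sequence of Cantor sets accumulating at `0`. -/
def timeSet : Set ℝ := insert 0 (⋃ m, range (levelCode m))

theorem levelDim_pos (m : ℕ) : 0 < levelDim m := by
  have h : (0 : ℝ) < m + 2 := by positivity
  rw [levelDim, sub_pos, div_lt_one h]
  have : (0 : ℝ) ≤ m := m.cast_nonneg
  linarith

theorem levelDim_lt_one (m : ℕ) : levelDim m < 1 := by
  have h : (0 : ℝ) < 1 / (m + 2) := by positivity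
  rw [levelDim]
  linarith

theorem levelDim_mono : Monotone levelDim := by
  intro m k h
  rw [levelDim, levelDim]
  gcongr

theorem exists_lt_levelDim {s : ℝ} (hs : s < 1) : ∃ m, s < levelDim m := by
  obtain ⟨m, hm⟩ := exists_nat_one_div_lt (sub_pos.2 hs)
  refine ⟨m, ?_⟩
  have : 1 / ((m : ℝ) + 2) ≤ 1 / (m + 1) := by gcongr; norm_num
  rw [levelDim]
  linarith

theorem levelRatio_pos (m : ℕ) : 0 < levelRatio m := Real.rpow_pos_of_pos (by norm_num) _

theorem levelRatio_lt (m : ℕ) : levelRatio m < 1 / 2 := by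
  have h : 1 < 1 / levelDim m := by
    rw [lt_div_iff₀ (levelDim_pos m), one_mul]
    exact levelDim_lt_one m
  have := Real.rpow_lt_rpow_of_exponent_gt (x := 2⁻¹) (by norm_num) (by norm_num) h
  rw [Real.rpow_one] at this
  exact this.trans_eq (one_div 2).symm

theorem levelRatio_rpow (m : ℕ) : levelRatio m ^ levelDim m = 2⁻¹ := by
  rw [levelRatio, ← Real.rpow_mul (by norm_num), one_div_mul_cancel (levelDim_pos m).ne',
    Real.rpow_one]

theorem isCantorCoding_levelCode (m : ℕ) :
    IsCantorCoding (levelRatio m) (2⁻¹ ^ m * (1 - 2 * levelRatio m) / 4) (levelCode m) := by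
  have hq := levelRatio_pos m
  have hq2 := levelRatio_lt m
  have h2 : (0 : ℝ) < 2⁻¹ ^ m := by positivity
  have h21 : (2⁻¹ : ℝ) ^ m ≤ 1 := pow_le_one₀ (by norm_num) (by norm_num)
  have key : ∀ ε δ, |levelCode m ε - levelCode m δ| =
      2⁻¹ ^ m / 4 * |cantorSeries (levelRatio m) ε - cantorSeries (levelRatio m) δ| := by
    intro ε δ
    rw [← abs_of_pos (show (0 : ℝ) < 2⁻¹ ^ m / 4 by positivity)]
    rw [← abs_mul, levelCode, levelCode]
    ring_nf
  refine ⟨?_, fun k ε δ h => ?_, fun k ε δ h hk => ?_⟩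
  · have : 0 < 1 - 2 * levelRatio m := by linarith
    positivity
  · rw [key]
    have := abs_cantorSeries_sub_le hq.le hq2 h
    have h3 : 0 < levelRatio m ^ k := pow_pos hq k
    calc 2⁻¹ ^ m / 4 * |cantorSeries (levelRatio m) ε - cantorSeries (levelRatio m) δ|
        ≤ 1 / 4 * (2 * levelRatio m ^ k) := by gcongr
      _ ≤ levelRatio m ^ k := by linarith
  · rw [key]
    have := mul_le_mul_of_nonneg_left (le_abs_cantorSeries_sub hq.le hq2 h hk)
      (show (0 : ℝ) ≤ 2⁻¹ ^ m / 4 by positivity)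
    refine le_trans (le_of_eq ?_) this
    ring

theorem le_levelCode (m : ℕ) (ε : ℕ → Fin 2) : 2⁻¹ ^ m ≤ levelCode m ε := by
  have := cantorSeries_nonneg (levelRatio_pos m).le ε
  have h2 : (0 : ℝ) < 2⁻¹ ^ m := by positivity
  rw [levelCode]
  nlinarith

theorem levelCode_le (m : ℕ) (ε : ℕ → Fin 2) : levelCode m ε ≤ 2 * 2⁻¹ ^ m := by
  have := cantorSeries_le (levelRatio_pos m).le (levelRatio_lt m) ε
  have h2 : (0 : ℝ) < 2⁻¹ ^ m := by positivity
  rw [levelCode]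
  nlinarith

theorem isCompact_range_levelCode (m : ℕ) : IsCompact (range (levelCode m)) := by
  refine isCompact_range (continuous_const.mul (continuous_const.add
    (Continuous.div_const ?_ 4)))
  exact continuous_cantorSeries (levelRatio_pos m).le (by linarith [levelRatio_lt m])

theorem range_levelCode_subset (m : ℕ) : range (levelCode m) ⊆ timeSet :=
  (subset_iUnion (fun m => range (levelCode m)) m).trans (subset_insert _ _)

theorem pos_of_mem_range_levelCode {m : ℕ} {t : ℝ} (ht : t ∈ range (levelCode m)) : 0 < t := by
  obtain ⟨ε, rfl⟩ := ht
  exact (show (0 : ℝ) < 2⁻¹ ^ m by positivity).trans_le (le_levelCode m ε)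

theorem zero_mem_timeSet : (0 : ℝ) ∈ timeSet := mem_insert _ _

theorem timeSet_subset_Icc : timeSet ⊆ Icc 0 2 := by
  refine insert_subset (by simp) (iUnion_subset fun m => ?_)
  rintro t ht
  refine ⟨(pos_of_mem_range_levelCode ht).le, ?_⟩
  obtain ⟨ε, rfl⟩ := ht
  have h21 : (2⁻¹ : ℝ) ^ m ≤ 1 := pow_le_one₀ (by norm_num) (by norm_num)
  linarith [levelCode_le m ε]

theorem exists_timeSet_subset {ε : ℝ} (hε : 0 < ε) :
    ∃ M : ℕ, timeSet ⊆ Iic ε ∪ ⋃ m : Fin M, range (levelCode m) := by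
  obtain ⟨M, hM⟩ := exists_pow_lt_of_lt_one (half_pos hε) (by norm_num : (2⁻¹ : ℝ) < 1)
  refine ⟨M, insert_subset (.inl hε.le) (iUnion_subset fun m => ?_)⟩
  rintro t ht
  rcases lt_or_ge m M with h | h
  · exact .inr (mem_iUnion.2 ⟨⟨m, h⟩, ht⟩)
  · obtain ⟨δ, rfl⟩ := ht
    refine .inl (mem_Iic.2 ?_)
    have := pow_le_pow_of_le_one (by norm_num) (by norm_num : (2⁻¹ : ℝ) ≤ 1) h
    linarith [levelCode_le m δ]

theorem isCompact_timeSet : IsCompact timeSet := by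
  refine isCompact_Icc.of_isClosed_subset (isClosed_of_closure_subset fun x hx => ?_)
    timeSet_subset_Icc
  have hx0 : 0 ≤ x := (closure_minimal timeSet_subset_Icc isClosed_Icc hx).1
  rcases hx0.eq_or_lt with rfl | hx0
  · exact zero_mem_timeSet
  obtain ⟨M, hM⟩ := exists_timeSet_subset (half_pos hx0)
  have hcl : IsClosed (Iic (x / 2) ∪ ⋃ m : Fin M, range (levelCode m)) :=
    isClosed_Iic.union (isClosed_iUnion_of_finite fun m => (isCompact_range_levelCode m).isClosed)
  rcases closure_minimal hM hcl hx with h | h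
  · rw [mem_Iic] at h
    linarith
  · obtain ⟨m, hm⟩ := mem_iUnion.1 h
    exact range_levelCode_subset m hm

theorem coverBound_range_levelCode (m : ℕ) : CoverBound (levelDim m) (range (levelCode m)) :=
  (isCantorCoding_levelCode m).coverBound_range (levelRatio_pos m)
    (by linarith [levelRatio_lt m]) (levelRatio_rpow m)

theorem exists_coverBound_timeSet {ε : ℝ} (hε : 0 < ε) :
    ∃ s, 0 < s ∧ s < 1 ∧ CoverBound s (timeSet ∩ Ici ε) := by
  obtain ⟨M, hM⟩ := exists_timeSet_subset (half_pos hε)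
  refine ⟨levelDim M, levelDim_pos M, levelDim_lt_one M, (CoverBound.iUnion fun m : Fin M =>
    (coverBound_range_levelCode m).mono_exponent (levelDim_mono m.2.le)).mono ?_⟩
  rintro t ⟨ht, htε⟩
  refine (hM ht).resolve_left fun h => ?_
  rw [mem_Iic] at h
  rw [mem_Ici] at htε
  linarith

theorem exists_notMem_timeSet {a b : ℝ} (hab : a < b) : ∃ c ∈ Ioo a b, c ∉ timeSet := by
  by_contra! h
  have h0 : volume timeSet = 0 := by
    refine measure_mono_null (insert_eq _ _).subset (measure_union_null (by simp)
      (measure_iUnion_null fun m => ?_))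
    obtain ⟨s, hs, hs1⟩ := exists_between (levelDim_lt_one m)
    have hs0 := (levelDim_pos m).trans hs
    refine measure_zero_of_dimH_lt (d := 1) ?_ ?_
    · rw [NNReal.coe_one, hausdorffMeasure_real]
    · refine (dimH_le_of_forall_smallCover (s := ⟨s, hs0.le⟩) fun η hη => ?_).trans_lt
        (ENNReal.coe_lt_coe.2 hs1)
      obtain ⟨U, -, hU, hsm⟩ := (coverBound_range_levelCode m).exists_isOpen_smallCover hs0 hs hη
      obtain ⟨ι, hι, t, h1, h2⟩ := hsm
      exact ⟨ι, hι, t, hU.trans h1, h2⟩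
  have := measure_mono_null (show Ioo a b ⊆ timeSet from h) h0
  rw [Real.volume_Ioo, ENNReal.ofReal_eq_zero] at this
  linarith

theorem levelDim_le_dimH (m : ℕ) :
    ENNReal.ofReal (levelDim m) ≤ dimH (range (levelCode m)) := by
  have h := levelDim_pos m
  refine (isCantorCoding_levelCode m).le_dimH_range (levelRatio_pos m)
    (s := (levelDim m).toNNReal) (by simpa using h) ?_
  rw [Real.coe_toNNReal _ h.le]
  exact levelRatio_rpow m

end TimeSet

theorem MvPolynomial.aeval_pi_apply {σ R S : Type*} [CommRing R] (v : σ → S → R)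
    (p : MvPolynomial σ R) (x : S) :
    aeval v p x = eval (fun i => v i x) p := by
  have : (Pi.evalAlgHom R (fun _ : S => R) x).comp (aeval v) = aeval fun i => v i x := by
    ext i
    simp
  have h := DFunLike.congr_fun this p
  rw [← coe_aeval_eq_eval]
  exact h

/-- A polynomial system whose leading part is the diagonal power system has finitely many
solutions. -/
theorem finite_setOf_eval_add_pow_eq {σ : Type*} [Finite σ] {d : ℕ}
    {p : σ → MvPolynomial σ ℝ} (hp : ∀ i, (p i).totalDegree < d) {η : ℝ} (hη : η ≠ 0)
    (y : σ → ℝ) : {x : σ → ℝ | ∀ i, MvPolynomial.eval x (p i) + η * x i ^ d = y i}.Finite := by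
  classical
  have := Fintype.ofFinite σ
  set S : Set (σ → ℝ) := {x | ∀ i, MvPolynomial.eval x (p i) + η * x i ^ d = y i} with hS
  let E : MvPolynomial σ ℝ →ₐ[ℝ] (S → ℝ) := MvPolynomial.aeval fun i x => x.1 i
  have hE : ∀ g x, E g x = MvPolynomial.eval x.1 g := fun g x =>
    MvPolynomial.aeval_pi_apply _ g x
  let B : Set (σ →₀ ℕ) := {s | ∀ i, s i < d}
  have hB : B.Finite := by
    refine Finite.of_finite_image (f := fun s i => s i)
      ((Set.Finite.pi fun _ : σ => Set.finite_Iio d).subset ?_)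
      fun s _ t _ h => DFunLike.coe_injective h
    rintro _ ⟨s, hs, rfl⟩ i -
    exact hs i
  let W : Submodule ℝ (S → ℝ) := Submodule.span ℝ ((fun s => E (MvPolynomial.monomial s 1)) '' B)
  have hW : ∀ N, ∀ g : MvPolynomial σ ℝ, g.totalDegree < N → E g ∈ W := by
    intro N
    induction N with
    | zero => exact fun g hg => absurd hg (Nat.not_lt_zero _)
    | succ N ih =>
      intro g hg
      rw [g.as_sum, map_sum]
      refine Submodule.sum_mem _ fun s hs => ?_
      have hsN : (s.sum fun _ e => e) ≤ N :=
        (MvPolynomial.le_totalDegree hs).trans (Nat.lt_succ_iff.1 hg)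
      rw [← mul_one (MvPolynomial.coeff s g), ← smul_eq_mul, ← MvPolynomial.smul_monomial, map_smul]
      refine Submodule.smul_mem _ _ ?_
      by_cases hsB : s ∈ B
      · exact Submodule.subset_span ⟨s, hsB, rfl⟩
      · obtain ⟨i, hi⟩ : ∃ i, d ≤ s i := by simpa [B] using hsB
        have hd : 0 < d := (Nat.zero_le _).trans_lt (hp i)
        have hst : s - Finsupp.single i d + Finsupp.single i d = s :=
          tsub_add_cancel_of_le (Finsupp.single_le_iff.2 hi)
        set t := s - Finsupp.single i d
        have hdeg : (t.sum fun _ e => e) + d = s.sum fun _ e => e := by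
          rw [← hst, Finsupp.sum_add_index' (fun _ => rfl) (fun _ _ _ => rfl),
            Finsupp.sum_single_index rfl]
        have heq : E (MvPolynomial.monomial s 1) = E (MvPolynomial.monomial t 1 *
            (MvPolynomial.C η⁻¹ * (MvPolynomial.C (y i) - p i))) := by
          funext x
          have hx : MvPolynomial.eval x.1 (p i) + η * x.1 i ^ d = y i := x.2 i
          rw [hE, hE, ← hst, ← mul_one (1 : ℝ), ← MvPolynomial.monomial_mul, mul_one, map_mul,
            map_mul, map_mul, map_sub, MvPolynomial.eval_C, MvPolynomial.eval_C,
            ← MvPolynomial.X_pow_eq_monomial, map_pow, MvPolynomial.eval_X, ← hx]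
          field_simp
          ring
        rw [heq]
        refine ih _ ((MvPolynomial.totalDegree_mul _ _).trans_lt ?_)
        have h1 : (MvPolynomial.C η⁻¹ * (MvPolynomial.C (y i) - p i)).totalDegree ≤
            (p i).totalDegree := by
          refine (MvPolynomial.totalDegree_mul _ _).trans ?_
          rw [MvPolynomial.totalDegree_C, zero_add]
          refine (MvPolynomial.totalDegree_sub _ _).trans ?_
          simp
        have h2 : (MvPolynomial.monomial t (1 : ℝ)).totalDegree ≤ t.sum fun _ e => e :=
          MvPolynomial.totalDegree_monomial_le t 1
        have h3 := hp i
        omega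
  have hfin : FiniteDimensional ℝ E.range := by
    have hWf : FiniteDimensional ℝ W := FiniteDimensional.span_of_finite ℝ (hB.image _)
    refine Submodule.finiteDimensional_of_le (S₁ := Subalgebra.toSubmodule E.range) (S₂ := W) ?_
    rintro _ ⟨g, rfl⟩
    exact hW _ g (Nat.lt_succ_self _)
  have hint : ∀ i, ∃ q : Polynomial ℝ, q ≠ 0 ∧ ∀ x ∈ S, q.IsRoot (x i) := fun i => by
    have hi : IsIntegral ℝ (E.rangeRestrict (MvPolynomial.X i)) := Algebra.IsIntegral.isIntegral _
    obtain ⟨q, hq, hq0⟩ := hi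
    refine ⟨q, hq.ne_zero, fun x hx => ?_⟩
    let φ : E.range →ₐ[ℝ] ℝ := (Pi.evalAlgHom ℝ (fun _ : S => ℝ) ⟨x, hx⟩).comp E.range.val
    have h1 : φ (E.rangeRestrict (MvPolynomial.X i)) = x i :=
      (hE _ _).trans (MvPolynomial.eval_X i)
    have h2 := Polynomial.aeval_algHom_apply φ (E.rangeRestrict (MvPolynomial.X i)) q
    rw [h1, Polynomial.aeval_def (E.rangeRestrict _) q, hq0, map_zero] at h2
    simpa [Polynomial.IsRoot] using h2
  choose q hq0 hq using hint
  refine (Set.Finite.pi fun i => (q i).roots.toFinset.finite_toSet).subset fun x hx i _ => ?_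
  simp [hq0 i, (hq i x hx).eq_zero]

/-- The cone `{(x, t) : t ∈ timeSet, x ∈ [0, t]ⁿ}`. -/
def cone (n : ℕ) : Set (Fin (n + 1) → ℝ) :=
  {z | z (Fin.last n) ∈ timeSet ∧ ∀ i : Fin n, z i.castSucc ∈ Icc 0 (z (Fin.last n))}

/-- The last coordinate of a point of the cone. -/
def height {n : ℕ} (z : cone n) : ℝ := z.1 (Fin.last n)

/-- The first `n` coordinates of a point of the cone. -/
def base {n : ℕ} (z : cone n) : Fin n → ℝ := fun i => z.1 i.castSucc

section Cone

variable {n : ℕ}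

theorem height_mem (z : cone n) : height z ∈ timeSet := z.2.1

theorem base_mem (z : cone n) (i : Fin n) : base z i ∈ Icc 0 (height z) := z.2.2 i

theorem height_nonneg (z : cone n) : 0 ≤ height z := (timeSet_subset_Icc z.2.1).1

theorem continuous_height : Continuous (height (n := n)) :=
  (continuous_apply _).comp continuous_subtype_val

theorem continuous_base : Continuous (base (n := n)) :=
  continuous_pi fun i => (continuous_apply i.castSucc).comp continuous_subtype_val

theorem cone_ext {z w : cone n} (hb : base z = base w) (hh : height z = height w) : z = w :=
  Subtype.ext (funext fun i => Fin.lastCases hh (fun j => congrFun hb j) i)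

/-- The point of the cone with given base and height. -/
def mkCone (x : Fin n → ℝ) (t : ℝ) (ht : t ∈ timeSet) (hx : ∀ i, x i ∈ Icc 0 t) : cone n :=
  ⟨Fin.snoc x t, by simpa [cone] using ⟨ht, hx⟩⟩

theorem base_mkCone {x : Fin n → ℝ} {t : ℝ} (ht : t ∈ timeSet) (hx : ∀ i, x i ∈ Icc 0 t) :
    base (mkCone x t ht hx) = x :=
  funext fun i => Fin.snoc_castSucc (α := fun _ => ℝ) _ _ i

theorem height_mkCone {x : Fin n → ℝ} {t : ℝ} (ht : t ∈ timeSet) (hx : ∀ i, x i ∈ Icc 0 t) :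
    height (mkCone x t ht hx) = t :=
  Fin.snoc_last (α := fun _ => ℝ) _ _

/-- The apex of the cone. -/
def apex (n : ℕ) : cone n := mkCone 0 0 zero_mem_timeSet fun _ => by simp

theorem eq_apex_of_height_eq_zero {z : cone n} (hz : height z = 0) : z = apex n := by
  refine cone_ext ?_ (hz.trans (height_mkCone _ _).symm)
  rw [apex, base_mkCone]
  funext i
  have := base_mem z i
  rw [hz, Icc_self] at this
  exact this

theorem isCompact_cone (n : ℕ) : IsCompact (cone n) := by
  have hc := isCompact_univ_pi fun _ : Fin (n + 1) => isCompact_Icc (a := (0 : ℝ)) (b := 2)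
  refine hc.of_isClosed_subset ?_ fun z hz i _ => ?_
  · have h1 : IsClosed {z : Fin (n + 1) → ℝ | z (Fin.last n) ∈ timeSet} :=
      isCompact_timeSet.isClosed.preimage (continuous_apply _)
    have h2 (i : Fin n) : IsClosed {z : Fin (n + 1) → ℝ | z i.castSucc ∈ Icc 0 (z (Fin.last n))} :=
      (isClosed_le continuous_const (continuous_apply i.castSucc)).inter
        (isClosed_le (continuous_apply i.castSucc) (continuous_apply (Fin.last n)))
    have h := h1.inter (isClosed_iInter h2)
    rwa [← ofPred_forall] at h
  · have h := timeSet_subset_Icc hz.1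
    refine Fin.lastCases h (fun j => ?_) i
    exact ⟨(hz.2 j).1, (hz.2 j).2.trans h.2⟩

instance : CompactSpace (cone n) := isCompact_iff_compactSpace.1 (isCompact_cone n)

theorem coverBound_cone {a b : ℝ} {A : Fin n → Set ℝ} {B : Set ℝ}
    (hA : ∀ i, CoverBound a (A i)) (hB : CoverBound b B) :
    CoverBound (n * a + b) {z : cone n | (∀ i, base z i ∈ A i) ∧ height z ∈ B} := by
  have h : CoverBound (∑ k, Fin.snoc (α := fun _ => ℝ) (fun _ : Fin n => a) b k)
      (univ.pi (Fin.snoc (α := fun _ => Set ℝ) A B)) := by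
    refine CoverBound.pi fun k => Fin.lastCases ?_ (fun i => ?_) k
    · simpa using hB
    · simpa using hA i
  have hsum : (∑ k, Fin.snoc (α := fun _ => ℝ) (fun _ : Fin n => a) b k) = n * a + b := by
    simp [Fin.sum_univ_castSucc]
  rw [hsum] at h
  refine (h.preimage (f := ((↑) : cone n → _)) isometry_subtype_coe).mono ?_
  rintro z ⟨h1, h2⟩ k -
  refine Fin.lastCases ?_ (fun i => ?_) k
  · simpa [height] using h2
  · simpa [base] using h1 i

theorem base_mem_Icc (z : cone n) (i : Fin n) : base z i ∈ Icc (0 : ℝ) 2 :=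
  ⟨(base_mem z i).1, (base_mem z i).2.trans (timeSet_subset_Icc (height_mem z)).2⟩

theorem coverBound_univ_cone : CoverBound (n + 1 : ℝ) (univ : Set (cone n)) := by
  have := coverBound_cone (n := n) (fun _ => coverBound_one_Icc 0 2) (coverBound_one_Icc 0 2)
  rw [mul_one] at this
  exact this.mono fun z _ => ⟨base_mem_Icc z, timeSet_subset_Icc (height_mem z)⟩

theorem exists_coverBound_height_ge {ε : ℝ} (hε : 0 < ε) :
    ∃ s : ℝ, 0 < s ∧ s < 1 ∧ CoverBound (n + s) {z : cone n | ε ≤ height z} ∧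
      ∀ A : Set (Fin n → ℝ), A.Finite → CoverBound s {z : cone n | ε ≤ height z ∧ base z ∈ A} := by
  obtain ⟨s, hs, hs1, h⟩ := exists_coverBound_timeSet hε
  refine ⟨s, hs, hs1, ?_, fun A hA => ?_⟩
  · have := coverBound_cone (n := n) (fun _ => coverBound_one_Icc 0 2) h
    rw [mul_one] at this
    exact this.mono fun z hz => ⟨base_mem_Icc z, height_mem z, hz⟩
  · have := coverBound_cone (n := n)
      (fun i => coverBound_zero_of_finite (hA.image fun x => x i)) h
    rw [mul_zero, zero_add] at this
    exact this.mono fun z hz => ⟨fun i => ⟨_, hz.2, rfl⟩, height_mem z, hz.1⟩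

theorem coverBound_base_eq (q : Fin n → ℝ) : CoverBound 1 {z : cone n | base z = q} := by
  have := coverBound_cone (n := n)
    (fun i => coverBound_zero_of_finite (finite_singleton (q i))) (coverBound_one_Icc 0 2)
  rw [mul_zero, zero_add] at this
  exact this.mono fun z hz => ⟨fun i => congrFun hz i, timeSet_subset_Icc (height_mem z)⟩

theorem exists_fiber_subset {f : C(cone n, Fin n → ℝ)} {y : Fin n → ℝ} (hy : y ≠ f (apex n)) :
    ∃ m : ℕ, f ⁻¹' {y} ⊆ {z | 1 / (m + 1 : ℝ) ≤ height z} := by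
  have hc : IsCompact (f ⁻¹' {y}) := (isClosed_singleton.preimage f.continuous).isCompact
  obtain ⟨ε, hε, h⟩ := hc.exists_forall_le' (a := 0) continuous_height.continuousOn fun z hz =>
    (height_nonneg z).lt_of_ne' fun h => hy (by rw [← eq_apex_of_height_eq_zero h]; exact hz.symm)
  obtain ⟨m, hm⟩ := exists_nat_one_div_lt hε
  exact ⟨m, fun z hz => hm.le.trans (h z hz)⟩

theorem pdim_fiber_lt {f : C(cone n, Fin n → ℝ)} {y : Fin n → ℝ} (hy : y ≠ f (apex n)) :
    pdim (f ⁻¹' {y}) < (n : EReal) + 1 := by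
  obtain ⟨m, hm⟩ := exists_fiber_subset hy
  obtain ⟨s, hs, hs1, h, -⟩ :=
    exists_coverBound_height_ge (n := n) (show 0 < 1 / (m + 1 : ℝ) by positivity)
  refine ((h.mono hm).pdim_le (by positivity)).trans_lt ?_
  have : ((n + s : ℝ) : EReal) < ((n + 1 : ℝ) : EReal) :=
    EReal.coe_lt_coe_iff.2 (by linarith)
  exact this

theorem dStar_pdim_le : dStar pdim n (univ : Set (cone n)) ≤ (n : EReal) + 1 := by
  refine sInf_le_of_le ⟨∅, ⟨fun _ => ∅, fun _ => isClosed_empty, by simp⟩, ?_, rfl⟩ ?_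
  · refine indDim_le_iff.2 (indBelow_mono n.zero_le ?_)
    exact (inferInstance : IsEmpty (∅ : Set (cone n)))
  · rw [sdiff_empty]
    exact coverBound_univ_cone.pdim_le (by positivity)

end Cone

section LowerBounds

variable {n : ℕ}

theorem abs_height_sub_le (z w : cone n) : |height z - height w| ≤ dist z w :=
  dist_le_pi_dist z.1 w.1 (Fin.last n)

theorem abs_base_sub_le (z w : cone n) (i : Fin n) : |base z i - base w i| ≤ dist z w :=
  dist_le_pi_dist z.1 w.1 i.castSucc

theorem dist_cone_le {z w : cone n} {r : ℝ} (hr : 0 ≤ r) (hb : ∀ i, |base z i - base w i| ≤ r)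
    (hh : |height z - height w| ≤ r) : dist z w ≤ r :=
  (dist_pi_le_iff hr).2 fun i => Fin.lastCases hh hb i

theorem not_box_subset_of_indBelow {A : Set (cone n)} (hA : indBelow n A) {l : Fin n → ℝ}
    {w t : ℝ} (hw : 0 < w) (ht : t ∈ timeSet) (hl : ∀ i, 0 ≤ l i) (hlt : ∀ i, l i + w ≤ t) :
    ∃ z : cone n, height z = t ∧ (∀ i, base z i ∈ Icc (l i) (l i + w)) ∧ z ∉ A := by
  by_contra! h
  let φ : closedBall (0 : EuclideanSpace ℝ (Fin n)) 1 → Fin n → ℝ :=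
    fun v i => l i + w * ((1 + v.1 i) / 2)
  have hφ (v) (i) : φ v i ∈ Icc (l i) (l i + w) := by
    have h1 : |v.1 i| ≤ 1 :=
      (PiLp.norm_apply_le v.1 i).trans (mem_closedBall_zero_iff.1 v.2)
    rw [abs_le] at h1
    exact ⟨by simp only [φ]; nlinarith, by simp only [φ]; nlinarith⟩
  have hφt (v) (i) : φ v i ∈ Icc 0 t :=
    ⟨(hl i).trans (hφ v i).1, (hφ v i).2.trans (hlt i)⟩
  let Φ : closedBall (0 : EuclideanSpace ℝ (Fin n)) 1 → A := fun v =>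
    ⟨mkCone (φ v) t ht (hφt v), h _ (height_mkCone _ _) fun i => by
      rw [base_mkCone]; exact hφ v i⟩
  have hΦ : Continuous Φ := by
    refine Continuous.subtype_mk (Continuous.subtype_mk (continuous_pi fun k => ?_) _) _
    refine Fin.lastCases ?_ (fun i => ?_) k
    · simpa using continuous_const
    · simp only [Fin.snoc_castSucc, φ]
      fun_prop
  have hinj : Function.Injective Φ := by
    intro v v' hv
    have hb : φ v = φ v' := by
      have := congrArg (fun z : A => base z.1) hv
      simpa only [Φ, base_mkCone] using this
    refine Subtype.ext (PiLp.ext fun i => ?_)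
    have := congrFun hb i
    simp only [φ] at this
    have := mul_left_cancel₀ hw.ne' (add_left_cancel this)
    linarith
  exact not_indBelow_closedBall n
    (indBelow_of_isInducing n (hΦ.isClosedEmbedding hinj).isInducing hA)

theorem packPre0_eq_top_of_box {m : ℕ} {B : Set (cone n)} {l : Fin n → ℝ} {w t : ℝ} (hw : 0 < w)
    (ht : t ∈ range (levelCode m)) (hl : ∀ i, 0 ≤ l i) (hlt : ∀ i, l i + w ≤ t - w)
    (hB : ∀ z : cone n, height z ∈ range (levelCode m) → |height z - t| ≤ w →
      (∀ i, base z i ∈ Icc (l i) (l i + w)) → z ∈ closure B)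
    {s : ℝ} (hsn : s < n + levelDim m) :
    packPre0 (fun r => r ^ s) B = ∞ := by
  set q := levelRatio m with hq_def
  have hq : 0 < q := levelRatio_pos m
  have hq1 : q < 1 := (levelRatio_lt m).trans (by norm_num)
  obtain ⟨c, hc, hT⟩ := (isCantorCoding_levelCode m).exists_separated hq hq1 ht hw
  set κ := min c w / 4 with hκ_def
  have hκ : 0 < κ := by positivity
  refine packPre0_eq_top fun δ hδ M => ?_
  have hlim1 : Tendsto (fun j : ℕ => κ * q ^ j) atTop (𝓝 0) := by
    simpa using (tendsto_pow_atTop_nhds_zero_of_lt_one hq.le hq1).const_mul κ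
  have hgt : 1 < q ^ (s - (n + levelDim m)) :=
    Real.one_lt_rpow_of_pos_of_lt_one_of_neg hq hq1 (by linarith)
  have hlim2 : Tendsto (fun j : ℕ => κ ^ s * (q ^ (s - (n + levelDim m))) ^ j) atTop atTop :=
    (tendsto_pow_atTop_atTop_of_one_lt hgt).const_mul_atTop (Real.rpow_pos_of_pos hκ s)
  obtain ⟨j, hj1, hj2⟩ :=
    ((hlim1.eventually (gt_mem_nhds (show (0 : ℝ) < δ from hδ))).and
      (hlim2.eventually_ge_atTop (M : ℝ))).exists
  obtain ⟨T, hTmem, hTcard, hTsep⟩ := hT j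
  have hqj : 0 < q ^ j := pow_pos hq j
  set N := ⌊(q ^ j)⁻¹⌋₊ with hN
  have hNle : (N : ℝ) * q ^ j ≤ 1 := by
    rw [← le_div_iff₀ hqj, one_div]
    exact Nat.floor_le (by positivity)
  have hmemI (k : Fin n → Fin (N + 1)) (i : Fin n) :
      l i + (k i : ℕ) * (w * q ^ j) ∈ Icc (l i) (l i + w) := by
    have h1 : ((k i : ℕ) : ℝ) ≤ N := by exact_mod_cast Nat.lt_succ_iff.1 (k i).2
    have h2 : ((k i : ℕ) : ℝ) * q ^ j ≤ 1 := (mul_le_mul_of_nonneg_right h1 hqj.le).trans hNle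
    refine ⟨le_add_of_nonneg_right (by positivity), ?_⟩
    nlinarith
  have hmemt (y : T) : y.1 ∈ timeSet := range_levelCode_subset m (hTmem _ y.2).1
  let Ψ : (Fin n → Fin (N + 1)) × T → cone n := fun p =>
    mkCone (fun i => l i + (p.1 i : ℕ) * (w * q ^ j)) p.2.1 (hmemt p.2) fun i => by
      have h1 := hmemI p.1 i
      have h2 := abs_le.1 (hTmem _ p.2.2).2
      exact ⟨(hl i).trans h1.1, h1.2.trans (by linarith [hlt i])⟩
  have hΨb (p) : base (Ψ p) = fun i => l i + (p.1 i : ℕ) * (w * q ^ j) := base_mkCone _ _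
  have hΨh (p) : height (Ψ p) = p.2.1 := height_mkCone _ _
  have hsep (p p') (hp : p ≠ p') : 4 * (κ * q ^ j) ≤ dist (Ψ p) (Ψ p') := by
    have h4 : 4 * (κ * q ^ j) = min c w * q ^ j := by rw [hκ_def]; ring
    rw [h4]
    by_cases h1 : p.1 = p'.1
    · have h2 : p.2.1 ≠ p'.2.1 := fun h => hp (Prod.ext h1 (Subtype.ext h))
      have h3 := hTsep _ p.2.2 _ p'.2.2 h2
      have h5 := abs_height_sub_le (Ψ p) (Ψ p')
      rw [hΨh, hΨh] at h5
      exact (mul_le_mul_of_nonneg_right (min_le_left _ _) hqj.le).trans (h3.trans h5)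
    · obtain ⟨i, hi⟩ := Function.ne_iff.1 h1
      have h5 := abs_base_sub_le (Ψ p) (Ψ p') i
      rw [hΨb, hΨb] at h5
      have h6 : (1 : ℝ) ≤ |((p.1 i : ℕ) : ℝ) - ((p'.1 i : ℕ) : ℝ)| := by
        have h7 : ((p.1 i : ℕ) : ℤ) - ((p'.1 i : ℕ) : ℤ) ≠ 0 := by
          intro h
          exact hi (Fin.ext (by omega))
        exact_mod_cast Int.one_le_abs h7
      have h8 : l i + (p.1 i : ℕ) * (w * q ^ j) - (l i + (p'.1 i : ℕ) * (w * q ^ j)) =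
          (((p.1 i : ℕ) : ℝ) - ((p'.1 i : ℕ) : ℝ)) * (w * q ^ j) := by ring
      rw [h8, abs_mul, abs_of_pos (mul_pos hw hqj)] at h5
      have h9 : w * q ^ j ≤ |((p.1 i : ℕ) : ℝ) - ((p'.1 i : ℕ) : ℝ)| * (w * q ^ j) :=
        le_mul_of_one_le_left (by positivity) h6
      exact (mul_le_mul_of_nonneg_right (min_le_right _ _) hqj.le).trans (h9.trans h5)
  have hinj : Function.Injective Ψ := by
    intro p p' h
    by_contra hne
    have := hsep p p' hne
    rw [h, dist_self] at this
    linarith [mul_pos hκ hqj]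
  refine ⟨⟨κ * q ^ j, by positivity⟩, mul_pos hκ hqj, hj1.le,
    Finset.univ.map ⟨Ψ, hinj⟩, ?_, ?_, ?_⟩
  · intro z hz
    obtain ⟨p, rfl⟩ : ∃ p, Ψ p = z := by simpa using hz
    refine hB _ ?_ ?_ fun i => ?_
    · rw [hΨh]; exact (hTmem _ p.2.2).1
    · rw [hΨh]; exact (hTmem _ p.2.2).2
    · rw [hΨb]; exact hmemI p.1 i
  · intro z hz z' hz' hne
    obtain ⟨p, rfl⟩ : ∃ p, Ψ p = z := by simpa using hz
    obtain ⟨p', rfl⟩ : ∃ p, Ψ p = z' := by simpa using hz'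
    exact hsep p p' fun h => hne (by rw [h])
  · rw [← NNReal.coe_le_coe]
    refine hj2.trans ?_
    push_cast
    rw [Finset.card_map, Finset.card_univ, Fintype.card_prod, Fintype.card_fun, Fintype.card_fin,
      Fintype.card_fin, Fintype.card_coe, hTcard]
    push_cast
    have hcount : ((q ^ j)⁻¹) ^ n ≤ ((N : ℝ) + 1) ^ n :=
      pow_le_pow_left₀ (by positivity) (Nat.lt_floor_add_one _).le n
    have h2 : (2 : ℝ) ^ j = ((q ^ j) ^ levelDim m)⁻¹ := by
      rw [IsCantorCoding.pow_rpow hq (levelRatio_rpow m), inv_pow, inv_inv]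
    have hkey : κ ^ s * (q ^ (s - (n + levelDim m))) ^ j =
        ((q ^ j)⁻¹) ^ n * 2 ^ j * (κ * q ^ j) ^ s := by
      rw [Real.mul_rpow hκ.le hqj.le, h2, ← Real.rpow_natCast, ← Real.rpow_mul hq.le,
        mul_comm _ (j : ℝ), Real.rpow_mul hq.le, Real.rpow_natCast, Real.rpow_sub hqj,
        Real.rpow_add hqj, Real.rpow_natCast, inv_pow]
      field_simp
    rw [hkey]
    gcongr
    exact (NNReal.coe_rpow ⟨κ * q ^ j, (mul_pos hκ hqj).le⟩ s).ge

theorem one_le_of_levelDim_le {x : EReal} (h : ∀ m, (levelDim m : EReal) ≤ x) : 1 ≤ x := by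
  refine EReal.ge_of_forall_gt_iff_ge.1 fun z hz => ?_
  obtain ⟨m, hm⟩ := exists_lt_levelDim (s := z) (by exact_mod_cast hz)
  exact (EReal.coe_le_coe_iff.2 hm.le).trans (h m)

theorem exists_height_eq_notMem {F : Set (cone n)} (hF : indBelow n F) {t : ℝ}
    (ht : t ∈ timeSet) (ht0 : 0 < t) : ∃ z : cone n, height z = t ∧ z ∉ F := by
  obtain ⟨z, hz, -, hzF⟩ := not_box_subset_of_indBelow hF (l := 0) ht0 ht (fun _ => le_rfl)
    fun _ => (zero_add t).le
  exact ⟨z, hz, hzF⟩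

theorem nonempty_range_levelCode (m : ℕ) : (range (levelCode m)).Nonempty :=
  range_nonempty _

theorem one_le_dStar_hdim : 1 ≤ dStar hdim n (univ : Set (cone n)) := by
  refine le_sInf ?_
  rintro _ ⟨F, -, hF, rfl⟩
  rw [tdim, indDim_le_iff] at hF
  have hsub (m : ℕ) : range (levelCode m) ⊆ height '' (univ \ F) := by
    intro t ht
    obtain ⟨z, hz, hzF⟩ := exists_height_eq_notMem hF (range_levelCode_subset m ht)
      (pos_of_mem_range_levelCode ht)
    exact ⟨z, ⟨mem_univ _, hzF⟩, hz⟩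
  have hne : univ \ F ≠ ∅ := fun h => by
    have h0 := hsub 0 (nonempty_range_levelCode 0).some_mem
    rw [h, image_empty] at h0
    exact h0
  have hlip : LipschitzWith 1 (height (n := n)) :=
    LipschitzWith.of_dist_le_mul fun z w => by
      rw [NNReal.coe_one, one_mul]
      exact abs_height_sub_le z w
  rw [hdim, if_neg hne]
  refine one_le_of_levelDim_le fun m => ?_
  have h1 := (levelDim_le_dimH m).trans ((dimH_mono (hsub m)).trans (hlip.dimH_image_le _))
  have h2 : ((ENNReal.ofReal (levelDim m) : ℝ≥0∞) : EReal) ≤ (dimH (univ \ F) : ℝ≥0∞) :=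
    EReal.coe_ennreal_le_coe_ennreal_iff.2 h1
  rwa [EReal.coe_ennreal_ofReal, max_eq_left (levelDim_pos m).le] at h2

theorem exists_box_subset {m : ℕ} {S : ℕ ⊕ ℕ → Set (cone n)} (hS : ∀ k, IsClosed (S k))
    (hu : ⋃ k, S k = univ) : ∃ k, ∃ (l : Fin n → ℝ) (w t : ℝ), 0 < w ∧ t ∈ range (levelCode m) ∧
      (∀ i, 0 ≤ l i) ∧ (∀ i, l i + w ≤ t - w) ∧
      ∀ z : cone n, height z ∈ range (levelCode m) → |height z - t| ≤ w →
        (∀ i, base z i ∈ Icc (l i) (l i + w)) → z ∈ S k := by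
  have hYc : IsClosed {z : cone n | height z ∈ range (levelCode m)} :=
    (isCompact_range_levelCode m).isClosed.preimage continuous_height
  have : CompactSpace {z : cone n | height z ∈ range (levelCode m)} :=
    isCompact_iff_compactSpace.1 hYc.isCompact
  have : Nonempty {z : cone n | height z ∈ range (levelCode m)} := by
    obtain ⟨t, ht⟩ := nonempty_range_levelCode m
    have ht' := range_levelCode_subset m ht
    have hx (i : Fin n) : (0 : Fin n → ℝ) i ∈ Icc 0 t :=
      left_mem_Icc.2 (pos_of_mem_range_levelCode ht).le
    refine ⟨mkCone 0 t ht' hx, ?_⟩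
    rwa [mem_ofPred_eq, height_mkCone]
  obtain ⟨k, z₀, hz₀⟩ := nonempty_interior_of_iUnion_of_closed
    (f := fun k => ((↑) : {z : cone n | height z ∈ range (levelCode m)} → cone n) ⁻¹' S k)
    (fun k => (hS k).preimage continuous_subtype_val) (by rw [← preimage_iUnion, hu, preimage_univ])
  obtain ⟨ρ, hρ, hball⟩ := Metric.mem_nhds_iff.1 (mem_interior_iff_mem_nhds.1 hz₀)
  have ht0 := pos_of_mem_range_levelCode z₀.2
  have hw : 0 < min ρ (height z₀.1) / 4 := by positivity
  have hw1 : min ρ (height z₀.1) / 4 ≤ ρ / 4 := by gcongr; exact min_le_left _ _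
  have hw2 : min ρ (height z₀.1) / 4 ≤ height z₀.1 / 4 := by gcongr; exact min_le_right _ _
  set w := min ρ (height z₀.1) / 4
  refine ⟨k, fun i => max (base z₀.1 i - 2 * w) 0, w, height z₀.1, hw, z₀.2,
    fun i => le_max_right _ _, fun i => ?_, fun z hz hzt hzb => ?_⟩
  · have := (base_mem z₀.1 i).2
    rcases max_cases (base z₀.1 i - 2 * w) 0 with h | h <;> linarith [h.1]
  · refine @hball ⟨z, hz⟩ (lt_of_le_of_lt (b := 2 * w) ?_ (by linarith))
    refine dist_cone_le (by positivity) (fun i => ?_) (hzt.trans (by linarith))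
    have h0 := (base_mem z₀.1 i).1
    obtain ⟨h1, h2⟩ := hzb i
    rw [abs_le]
    rcases max_cases (base z₀.1 i - 2 * w) 0 with h | h <;> constructor <;> linarith [h.1, h.2]

theorem le_dStar_pdim : (n : EReal) + 1 ≤ dStar pdim n (univ : Set (cone n)) := by
  refine le_sInf ?_
  rintro _ ⟨F, ⟨C, hC, hFC⟩, hF, rfl⟩
  rw [tdim, indDim_le_iff] at hF
  refine EReal.ge_of_forall_gt_iff_ge.1 fun z hz => ?_
  have hz' : z < n + 1 := by exact_mod_cast hz
  have hs : ((max z 0).toNNReal : ℝ) = max z 0 := Real.coe_toNNReal _ (le_max_right _ _)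
  obtain ⟨m, hm⟩ := exists_lt_levelDim (s := max z 0 - n)
    (by rcases max_cases z 0 with h | h <;> linarith [h.1, n.cast_nonneg (α := ℝ)])
  refine (EReal.coe_le_coe_iff.2 (le_max_left z 0)).trans ?_
  rw [← hs]
  refine le_pdim ?_ fun c hc => ?_
  · obtain ⟨t, ht⟩ := nonempty_range_levelCode m
    obtain ⟨z, -, hzF⟩ := exists_height_eq_notMem hF (range_levelCode_subset m ht)
      (pos_of_mem_range_levelCode ht)
    exact ⟨z, mem_univ _, hzF⟩
  · obtain ⟨k, l, w, t, hw, ht, hl, hlt, hsub⟩ := exists_box_subset (m := m)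
      (S := Sum.elim C fun j => closure (c j))
      (by rintro (i | j); exacts [hC i, isClosed_closure]) (by
        refine eq_univ_of_forall fun z => ?_
        by_cases hz : z ∈ F
        · rw [hFC, mem_iUnion] at hz
          obtain ⟨i, hi⟩ := hz
          exact mem_iUnion.2 ⟨.inl i, hi.1⟩
        · have hz1 : z ∈ univ \ F := ⟨mem_univ _, hz⟩
          rw [hc, mem_iUnion] at hz1
          obtain ⟨j, hj⟩ := hz1
          exact mem_iUnion.2 ⟨.inr j, subset_closure hj⟩)
    rcases k with i | j
    · obtain ⟨z, hzt, hzb, hzF⟩ := not_box_subset_of_indBelow hF hw (range_levelCode_subset m ht) hl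
        fun i => (hlt i).trans (sub_le_self t hw.le)
      refine absurd ?_ hzF
      rw [hFC]
      refine mem_iUnion.2 ⟨i, hsub z (hzt ▸ ht) ?_ hzb, mem_univ _⟩
      rw [hzt, sub_self, abs_zero]
      exact hw.le
    · refine ⟨j, packPre0_eq_top_of_box hw ht hl hlt hsub ?_⟩
      rw [hs]
      linarith

end LowerBounds

/-- The translate `ℚ + l √2` of the rationals. -/
def ratTranslate (l : ℕ) : Set ℝ := range fun q : ℚ => (q : ℝ) + l * √2

theorem exists_mem_ratTranslate (l : ℕ) {a b : ℝ} (hab : a < b) :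
    ∃ c ∈ Ioo a b, c ∈ ratTranslate l := by
  obtain ⟨q, hq1, hq2⟩ := exists_rat_btwn (sub_lt_sub_right hab (l * √2))
  exact ⟨q + l * √2, ⟨by linarith, by linarith⟩, q, rfl⟩

theorem eq_of_mem_ratTranslate {l l' : ℕ} {x : ℝ} (h : x ∈ ratTranslate l)
    (h' : x ∈ ratTranslate l') : l = l' := by
  obtain ⟨q, rfl⟩ := h
  obtain ⟨q', hq⟩ := h'
  by_contra hne
  have h0 : (l : ℝ) - l' ≠ 0 := sub_ne_zero.2 (Nat.cast_injective.ne hne)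
  refine irrational_sqrt_two ⟨(q' - q) / (l - l'), ?_⟩
  push_cast
  rw [div_eq_iff h0]
  simp only at hq
  linarith

section UpperBound

variable {n : ℕ}

/-- The points of `B` such that each of the first `j` translates of `ℚ` contains one of their base
coordinates. -/
def gridSection (B : Set (cone n)) (j : ℕ) : Set (cone n) :=
  {z | z ∈ B ∧ ∀ l < j, ∃ i, base z i ∈ ratTranslate l}

theorem gridSection_eq_empty {B : Set (cone n)}
    (hB : ∀ z ∈ B, ∃ i, ∀ l, base z i ∉ ratTranslate l) : gridSection B n = ∅ := by
  refine eq_empty_of_forall_notMem fun z hz => ?_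
  choose φ hφ using fun l : Fin n => hz.2 l l.2
  have hinj : Function.Injective φ := fun l l' h => by
    have h1 := hφ l
    rw [h] at h1
    exact Fin.ext (eq_of_mem_ratTranslate h1 (hφ l'))
  obtain ⟨i, hi⟩ := hB z hz.1
  obtain ⟨l, rfl⟩ := Finite.surjective_of_injective hinj i
  exact hi l (hφ l)

theorem indBelow_gridSection {B : Set (cone n)}
    (hB : ∀ z ∈ B, ∃ i, ∀ l, base z i ∉ ratTranslate l) :
    ∀ k j : ℕ, k + j = n → indBelow k (gridSection B j)
  | 0, j, h => by
    rw [zero_add] at h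
    subst h
    exact isEmpty_coe_sort.2 (gridSection_eq_empty hB)
  | k + 1, j, h => by
    intro x U hU hxU
    obtain ⟨δ, hδ, hball⟩ := Metric.isOpen_iff.1 hU x hxU
    choose a ha haj using fun i =>
      exists_mem_ratTranslate j (show base x.1 i - δ / 2 < base x.1 i by linarith)
    choose b hb hbj using fun i =>
      exists_mem_ratTranslate j (show base x.1 i < base x.1 i + δ / 2 by linarith)
    obtain ⟨c, hc, hct⟩ := exists_notMem_timeSet
      (show height x.1 - δ / 2 < height x.1 by linarith)
    obtain ⟨d, hd, hdt⟩ := exists_notMem_timeSet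
      (show height x.1 < height x.1 + δ / 2 by linarith)
    have hbc : Continuous fun z : gridSection B j => base z.1 :=
      continuous_base.comp continuous_subtype_val
    have hhc : Continuous fun z : gridSection B j => height z.1 :=
      continuous_height.comp continuous_subtype_val
    set V : Set (gridSection B j) :=
      (fun z => base z.1) ⁻¹' univ.pi (fun i => Ioo (a i) (b i)) ∩
        (fun z => height z.1) ⁻¹' Ioo c d with hV
    have hVo : IsOpen V :=
      ((isOpen_set_pi finite_univ fun i _ => isOpen_Ioo).preimage hbc).inter
        (isOpen_Ioo.preimage hhc)
    set W : Set (gridSection B j) :=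
      (fun z => base z.1) ⁻¹' univ.pi (fun i => Icc (a i) (b i)) ∩
        (fun z => height z.1) ⁻¹' Icc c d with hW
    have hWc : IsClosed W :=
      ((isClosed_set_pi fun i _ => isClosed_Icc).preimage hbc).inter (isClosed_Icc.preimage hhc)
    have hVW : V ⊆ W := fun z hz =>
      ⟨fun i hi => Ioo_subset_Icc_self (hz.1 i hi), Ioo_subset_Icc_self hz.2⟩
    refine ⟨V, hVo, ⟨fun i _ => ⟨(ha i).2, (hb i).1⟩, hc.2, hd.1⟩, fun z hz => hball ?_, ?_⟩
    · refine lt_of_le_of_lt (b := δ / 2) (dist_cone_le (by positivity) (fun i => ?_) ?_)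
        (by linarith)
      · obtain ⟨h1, h2⟩ := hz.1 i (mem_univ i)
        have := (ha i).1
        have := (hb i).2
        exact abs_le.2 ⟨by linarith, by linarith⟩
      · obtain ⟨h1, h2⟩ := hz.2
        have := hc.1
        have := hd.2
        exact abs_le.2 ⟨by linarith, by linarith⟩
    · have hfr (z : frontier V) : z.1.1 ∈ gridSection B (j + 1) := by
        obtain ⟨hz1, hz2⟩ : z.1 ∈ closure V \ V := hVo.frontier_eq.subset z.2
        have hzW : z.1 ∈ W := closure_minimal hVW hWc hz1
        refine ⟨z.1.2.1, fun l hl => ?_⟩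
        rcases Nat.lt_succ_iff_lt_or_eq.1 hl with hl | rfl
        · exact z.1.2.2 l hl
        · have hh : height z.1.1 ∈ Ioo c d := by
            refine ⟨hzW.2.1.lt_of_ne fun h => hct ?_, hzW.2.2.lt_of_ne fun h => hdt ?_⟩
            · exact h ▸ height_mem z.1.1
            · exact h ▸ height_mem z.1.1
          by_contra! hne
          refine hz2 ⟨fun i hi => ?_, hh⟩
          exact ⟨(hzW.1 i hi).1.lt_of_ne fun h => hne i (mem_of_eq_of_mem h.symm (haj i)),
            (hzW.1 i hi).2.lt_of_ne fun h => hne i (mem_of_eq_of_mem h (hbj i))⟩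
      have hind : IsInducing fun z : frontier V => (⟨z.1.1, hfr z⟩ : gridSection B (j + 1)) :=
        (IsInducing.subtypeVal.comp IsInducing.subtypeVal).codRestrict hfr
      exact indBelow_of_isInducing k hind (indBelow_gridSection hB k (j + 1) (by omega))

theorem hdim_le {X : Type*} [MetricSpace X] {A : Set X} {s : ℝ≥0} (h : dimH A ≤ s) :
    hdim A ≤ ((s : ℝ) : EReal) := by
  rw [hdim]
  split_ifs
  · exact (show (-1 : EReal) ≤ 0 by norm_num).trans (EReal.coe_nonneg.2 s.2)
  · exact EReal.coe_ennreal_le_coe_ennreal_iff.2 h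

theorem dStar_hdim_le : dStar hdim n (univ : Set (cone n)) ≤ 1 := by
  have hU (k l : ℕ) : ∃ U : Set (cone n), IsOpen U ∧
      ⋃ q : Fin n → ℕ × ℚ, {z | base z = fun i => (q i).2 + (q i).1 * √2} ⊆ U ∧
        SmallCover (1 + 1 / (k + 1)) (1 / (l + 1)) U := by
    refine exists_isOpen_smallCover_iUnion (fun q η hη => ?_) (by simp)
    have : (0 : ℝ) < 1 / (k + 1) := by positivity
    exact (coverBound_base_eq _).exists_isOpen_smallCover (by linarith) (by linarith) hη
  choose U hUo hUsub hU using hU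
  have hF (z) (hz : z ∈ ⋃ i : ℕ, (U i.unpair.1 i.unpair.2)ᶜ) :
      ∃ i, ∀ l, base z i ∉ ratTranslate l := by
    obtain ⟨p, hp⟩ := mem_iUnion.1 hz
    by_contra! h
    choose l q hq using h
    exact hp (hUsub _ _ (mem_iUnion.2 ⟨fun i => (l i, q i), funext fun i => (hq i).symm⟩))
  refine sInf_le_of_le ⟨⋃ i : ℕ, (U i.unpair.1 i.unpair.2)ᶜ,
    ⟨fun i => (U i.unpair.1 i.unpair.2)ᶜ, fun i => (hUo _ _).isClosed_compl,
      by simp only [inter_univ]⟩, ?_, rfl⟩ ?_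
  · refine indDim_le_iff.2 ?_
    have h := indBelow_gridSection hF n 0 (add_zero n)
    rwa [gridSection, show {z | z ∈ ⋃ i : ℕ, (U i.unpair.1 i.unpair.2)ᶜ ∧
      ∀ l < 0, ∃ i, base z i ∈ ratTranslate l} = ⋃ i : ℕ, (U i.unpair.1 i.unpair.2)ᶜ by
        ext; simp] at h
  · have hsub (k l : ℕ) : univ \ ⋃ i : ℕ, (U i.unpair.1 i.unpair.2)ᶜ ⊆ U k l := by
      rintro z ⟨-, hz⟩
      by_contra h
      refine hz (mem_iUnion.2 ⟨Nat.pair k l, ?_⟩)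
      rwa [Nat.unpair_pair]
    have hdim (k : ℕ) : dimH (univ \ ⋃ i : ℕ, (U i.unpair.1 i.unpair.2)ᶜ) ≤
        ((1 + 1 / (k + 1) : ℝ≥0) : ℝ≥0∞) := by
      refine dimH_le_of_forall_smallCover fun η hη => ?_
      obtain ⟨l, hl⟩ := ENNReal.exists_inv_nat_lt hη.ne'
      have hle : (1 / ((l : ℝ≥0∞) + 1)) ≤ η := by
        rw [one_div]
        exact (ENNReal.inv_le_inv.2 le_self_add).trans hl.le
      have := (hU k l).mono (hsub k l) hle
      push_cast
      exact this
    have : dimH (univ \ ⋃ i : ℕ, (U i.unpair.1 i.unpair.2)ᶜ) ≤ ((1 : ℝ≥0) : ℝ≥0∞) := by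
      have hlim : Tendsto (fun k : ℕ => ((1 + 1 / (k + 1) : ℝ≥0) : ℝ≥0∞)) atTop
          (𝓝 ((1 + 0 : ℝ≥0) : ℝ≥0∞)) :=
        ENNReal.tendsto_coe.2 (tendsto_one_div_add_atTop_nhds_zero_nat.const_add 1)
      rw [add_zero] at hlim
      exact ge_of_tendsto' hlim hdim
    exact hdim_le this

end UpperBound

section Generic

variable {n : ℕ}

theorem continuous_eval_locallyConstant (c : LocallyConstant timeSet (MvPolynomial (Fin n) ℝ)) :
    Continuous fun z : cone n => MvPolynomial.eval (base z) (c ⟨height z, height_mem z⟩) := by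
  refine continuous_iff_continuousAt.2 fun z => ?_
  have h1 : ContinuousAt
      (fun w : cone n => MvPolynomial.eval (base w) (c ⟨height z, height_mem z⟩)) z :=
    ((MvPolynomial.continuous_eval _).comp continuous_base).continuousAt
  refine h1.congr ?_
  have h2 : Continuous fun w : cone n => (⟨height w, height_mem w⟩ : timeSet) :=
    continuous_height.subtype_mk _
  filter_upwards [h2.continuousAt.eventually
    ((IsLocallyConstant.iff_eventually_eq _).1 c.isLocallyConstant _)] with w hw
  exact congrArg _ hw.symm

/-- Evaluation on the cone of polynomials in the base coordinates whose coefficients are locally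
constant functions of the height. -/
noncomputable def coneEval (n : ℕ) :
    LocallyConstant timeSet (MvPolynomial (Fin n) ℝ) →ₐ[ℝ] C(cone n, ℝ) where
  toFun c := ⟨_, continuous_eval_locallyConstant c⟩
  map_one' := by ext; simp
  map_mul' _ _ := by ext; simp
  map_zero' := by ext; simp
  map_add' _ _ := by ext; simp
  commutes' r := by
    ext z
    exact MvPolynomial.eval_C r

theorem coneEval_apply (c : LocallyConstant timeSet (MvPolynomial (Fin n) ℝ)) (z : cone n) :
    coneEval n c z = MvPolynomial.eval (base z) (c ⟨height z, height_mem z⟩) := rfl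

instance : CompactSpace timeSet := isCompact_iff_compactSpace.1 isCompact_timeSet

theorem isClopen_timeSet_lt {c : ℝ} (hc : c ∉ timeSet) : IsClopen {t : timeSet | t.1 < c} := by
  refine ⟨?_, isOpen_lt continuous_subtype_val continuous_const⟩
  have : {t : timeSet | t.1 < c} = {t : timeSet | t.1 ≤ c} := by
    ext t
    rw [mem_ofPred_eq, mem_ofPred_eq]
    exact ⟨le_of_lt, fun h => lt_of_le_of_ne h fun h => hc (mem_of_eq_of_mem h.symm t.2)⟩
  rw [this]
  exact isClosed_le continuous_subtype_val continuous_const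

theorem coneEval_range_separatesPoints : (coneEval n).range.SeparatesPoints := by
  have key {z w : cone n} (h : height z < height w) :
      ∃ c, coneEval n c z ≠ coneEval n c w := by
    obtain ⟨c, hc, hct⟩ := exists_notMem_timeSet h
    refine ⟨LocallyConstant.charFn _ (isClopen_timeSet_lt hct), ?_⟩
    rw [coneEval_apply, coneEval_apply, LocallyConstant.coe_charFn,
      indicator_of_mem (by exact hc.1), indicator_of_notMem (by exact hc.2.not_gt)]
    simp
  intro z w hzw
  suffices h : ∃ c, coneEval n c z ≠ coneEval n c w by
    obtain ⟨c, hc⟩ := h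
    exact ⟨_, ⟨coneEval n c, ⟨c, rfl⟩, rfl⟩, hc⟩
  rcases lt_trichotomy (height z) (height w) with h | h | h
  · exact key h
  · obtain ⟨i, hi⟩ := Function.ne_iff.1 fun hb => hzw (cone_ext hb h)
    refine ⟨LocallyConstant.const _ (MvPolynomial.X i), ?_⟩
    simpa [coneEval_apply] using hi
  · obtain ⟨c, hc⟩ := key h
    exact ⟨c, hc.symm⟩

/-- The maps whose fibers, truncated at height `ε`, have `σ`-dimensional covers of size `η`. -/
def smallFiberMaps (n : ℕ) (ε σ : ℝ) (η : ℝ≥0∞) : Set C(cone n, Fin n → ℝ) :=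
  {f | ∀ x, ∃ U, IsOpen U ∧ SmallCover σ η U ∧ ∀ z ∈ Uᶜ ∩ {z | ε ≤ height z}, f z ≠ f x}

theorem isOpen_smallFiberMaps (ε σ : ℝ) (η : ℝ≥0∞) : IsOpen (smallFiberMaps n ε σ η) := by
  refine isOpen_iff_eventually.2 fun f₀ hf₀ => ?_
  have h : ∀ᶠ f in 𝓝 f₀, ∀ x ∈ (univ : Set (cone n)), ∃ U, IsOpen U ∧ SmallCover σ η U ∧
      ∀ z ∈ Uᶜ ∩ {z | ε ≤ height z}, f z ≠ f x := by
    refine isCompact_univ.eventually_forall_of_forall_eventually fun x _ => ?_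
    obtain ⟨U, hUo, hU, hz⟩ := hf₀ x
    have hK : IsCompact (Uᶜ ∩ {z | ε ≤ height z}) :=
      (hUo.isClosed_compl.inter (isClosed_le continuous_const continuous_height)).isCompact
    have h : ∀ᶠ p : C(cone n, Fin n → ℝ) × cone n in 𝓝 (f₀, x),
        ∀ z ∈ Uᶜ ∩ {z | ε ≤ height z}, p.1 z ≠ p.1 p.2 := by
      refine hK.eventually_forall_of_forall_eventually fun z hzK => ?_
      have ho : IsOpen {p : (C(cone n, Fin n → ℝ) × cone n) × cone n | p.1.1 p.2 ≠ p.1.1 p.1.2} :=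
        isOpen_ne_fun (by fun_prop) (by fun_prop)
      exact ho.mem_nhds (hz z hzK)
    filter_upwards [h] with p hp using ⟨U, hUo, hU, hp⟩
  filter_upwards [h] with f hf x using hf x (mem_univ x)

theorem exists_near_finite_base (f : C(cone n, Fin n → ℝ)) {δ : ℝ} (hδ : 0 < δ) :
    ∃ g, dist f g < δ ∧ ∀ y, ∃ A : Set (Fin n → ℝ), A.Finite ∧ g ⁻¹' {y} ⊆ {z | base z ∈ A} := by
  have happrox (i : Fin n) : ∃ c, ∀ z, |coneEval n c z - f z i| < δ / 4 := by
    obtain ⟨⟨_, c, rfl⟩, hc⟩ :=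
      ContinuousMap.exists_mem_subalgebra_near_continuousMap_of_separatesPoints _
        coneEval_range_separatesPoints ⟨fun z => f z i, by fun_prop⟩ (δ / 4) (by positivity)
    exact ⟨c, fun z => (ContinuousMap.norm_coe_le_norm _ z).trans_lt hc⟩
  choose c hc using happrox
  have hdeg (i : Fin n) : ∃ d, ∀ t, (c i t).totalDegree ≤ d := by
    obtain ⟨d, hd⟩ := ((c i).range_finite.image MvPolynomial.totalDegree).bddAbove
    exact ⟨d, fun t => hd ⟨_, ⟨t, rfl⟩, rfl⟩⟩
  choose d hd using hdeg
  set D := ∑ i, d i + 1 with hD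
  have hdD (i t) : (c i t).totalDegree < D :=
    Nat.lt_succ_of_le ((hd i t).trans (Finset.single_le_sum (fun _ _ => Nat.zero_le _)
      (Finset.mem_univ i)))
  set α : ℝ := δ / 4 / 2 ^ D with hα
  have hα0 : 0 < α := by positivity
  let g : C(cone n, Fin n → ℝ) :=
    ⟨fun z i => coneEval n (c i) z + α * base z i ^ D, continuous_pi fun i =>
      (coneEval n (c i)).continuous.add
        (continuous_const.mul (((continuous_apply i).comp continuous_base).pow D))⟩
  have hg (z i) : g z i = coneEval n (c i) z + α * base z i ^ D := rfl
  refine ⟨g, lt_of_le_of_lt (b := δ / 2) ?_ (by linarith), fun y => ?_⟩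
  · refine (ContinuousMap.dist_le (by positivity)).2 fun z =>
      (dist_pi_le_iff (by positivity)).2 fun i => ?_
    rw [hg, Real.dist_eq]
    have h1 := abs_lt.1 (hc i z)
    have h2 : α * base z i ^ D ≤ δ / 4 := by
      have : base z i ^ D ≤ 2 ^ D :=
        pow_le_pow_left₀ (base_mem_Icc z i).1 (base_mem_Icc z i).2 D
      calc α * base z i ^ D ≤ α * 2 ^ D := by gcongr
        _ = δ / 4 := by rw [hα]; field_simp
    have h3 : 0 ≤ α * base z i ^ D := mul_nonneg hα0.le (pow_nonneg (base_mem_Icc z i).1 D)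
    exact abs_le.2 ⟨by linarith, by linarith⟩
  · refine ⟨⋃ p ∈ univ.pi fun i => range (c i),
      {x | ∀ i, MvPolynomial.eval x (p i) + α * x i ^ D = y i}, ?_, fun z hz => ?_⟩
    · refine (Finite.pi fun i => (c i).range_finite).biUnion fun p hp => ?_
      refine finite_setOf_eval_add_pow_eq (fun i => ?_) hα0.ne' y
      obtain ⟨t, ht⟩ := hp i (mem_univ i)
      rw [← ht]
      exact hdD i t
    · refine mem_biUnion (x := fun i => c i ⟨height z, height_mem z⟩)
        (fun i _ => mem_range_self _) fun i => ?_
      rw [← coneEval_apply, ← hg]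
      exact congrFun hz i

theorem dense_smallFiberMaps {ε s σ : ℝ} {η : ℝ≥0∞} (hσ : 0 < σ) (hs : s < σ) (hη : 0 < η)
    (h : ∀ A : Set (Fin n → ℝ), A.Finite → CoverBound s {z : cone n | ε ≤ height z ∧ base z ∈ A}) :
    Dense (smallFiberMaps n ε σ η) := by
  refine Metric.dense_iff.2 fun f δ hδ => ?_
  obtain ⟨g, hg, hfib⟩ := exists_near_finite_base f hδ
  refine ⟨g, by rwa [mem_ball, dist_comm], fun x => ?_⟩
  obtain ⟨A, hA, hAsub⟩ := hfib (g x)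
  obtain ⟨U, hUo, hAU, hU⟩ := (h A hA).exists_isOpen_smallCover hσ hs hη
  exact ⟨U, hUo, hU, fun z hz hzx => hz.1 (hAU ⟨hz.2, hAsub hzx⟩)⟩

theorem eventually_residual_hdim_fiber_lt :
    ∀ᶠ f : C(cone n, Fin n → ℝ) in residual C(cone n, Fin n → ℝ),
      ∀ y : Fin n → ℝ, y ≠ f (apex n) → hdim (f ⁻¹' {y}) < 1 := by
  choose s hs0 hs1 _ hs using fun m : ℕ =>
    exists_coverBound_height_ge (n := n) (show 0 < 1 / (m + 1 : ℝ) by positivity)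
  have hres : ∀ᶠ f : C(cone n, Fin n → ℝ) in residual C(cone n, Fin n → ℝ),
      ∀ m k : ℕ, f ∈ smallFiberMaps n (1 / (m + 1)) ((1 + s m) / 2) ((k : ℝ≥0∞)⁻¹) := by
    refine eventually_countable_forall.2 fun m => eventually_countable_forall.2 fun k => ?_
    exact residual_of_dense_open (isOpen_smallFiberMaps _ _ _)
      (dense_smallFiberMaps (by linarith [hs0 m]) (by linarith [hs1 m]) (by simp) (hs m))
  filter_upwards [hres] with f hf y hy
  obtain ⟨m, hm⟩ := exists_fiber_subset hy
  have hdim : dimH (f ⁻¹' {y}) ≤ ((((1 + s m) / 2).toNNReal : ℝ≥0) : ℝ≥0∞) := by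
    refine dimH_le_of_forall_smallCover fun η hη => ?_
    rw [Real.coe_toNNReal _ (by linarith [hs0 m])]
    obtain ⟨k, hk⟩ := ENNReal.exists_inv_nat_lt hη.ne'
    rcases (f ⁻¹' {y}).eq_empty_or_nonempty with he | ⟨x, hx⟩
    · rw [he]
      exact ⟨Empty, inferInstance, fun _ => ∅, empty_subset _, by simp, by simp⟩
    · obtain ⟨U, -, hU, hfU⟩ := hf m k x
      refine hU.mono (fun z hz => ?_) hk.le
      by_contra hzU
      exact hfU z ⟨hzU, hm hz⟩ (Eq.trans hz hx.symm)
  refine (hdim_le hdim).trans_lt ?_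
  rw [Real.coe_toNNReal _ (by linarith [hs0 m])]
  have : (((1 + s m) / 2 : ℝ) : EReal) < ((1 : ℝ) : EReal) :=
    EReal.coe_lt_coe_iff.2 (by linarith [hs1 m])
  exact this

end Generic

end Dimensions

/-- A compact set `K ⊆ ℝ^{n+1}` for which only one fiber can have maximal Hausdorff
(resp. packing) dimension. -/
theorem stmt15 (n : ℕ) (hn : 0 < n) :
    ∃ K : Set (Fin (n + 1) → ℝ), IsCompact K ∧
      ∃ yf : C(↥K, Fin n → ℝ) → (Fin n → ℝ),
        (dStar hdim n (Set.univ : Set ↥K) = 1 ∧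
          dStar pdim n (Set.univ : Set ↥K) = (n : EReal) + 1) ∧
        (∀ᶠ (f : C(↥K, Fin n → ℝ)) in residual C(↥K, Fin n → ℝ),
          ∀ y : Fin n → ℝ, y ≠ yf f → hdim (⇑f ⁻¹' {y}) < 1) ∧
        (∀ f : C(↥K, Fin n → ℝ),
          ∀ y : Fin n → ℝ, y ≠ yf f → pdim (⇑f ⁻¹' {y}) < (n : EReal) + 1) := by
  refine ⟨cone n, isCompact_cone n, fun f => f (apex n),
    ⟨le_antisymm dStar_hdim_le one_le_dStar_hdim, le_antisymm dStar_pdim_le le_dStar_pdim⟩,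
    eventually_residual_hdim_fiber_lt, fun f y hy => pdim_fiber_lt hy⟩
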